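/- arXiv:1003.1649 — 4 statements merged into one kernel-verified Lean document; each statement's English description precedes it below -/
import Mathlib

section
/- Let n ≥ 1 be an integer, let ρ ∈ [0,1], and let p, q be real numbers with 1 ≤ p, 1 ≤ q and p − 1 ≥ ρ²(q − 1). For every Borel measurable function f : ℝⁿ → [0,∞], define the Mehler transform P_ρ f(x) := ∫_{ℝⁿ} f(ρx + √(1−ρ²) y) dμ(y). Then (∫_{ℝⁿ} (P_ρ f(x))^q dμ(x))^{1/q} ≤ (∫_{ℝⁿ} f(x)^p dμ(x))^{1/p}, where all integrals are taken in [0,∞]. (Hypercontractivity of the Mehler/Ornstein–Uhlenbeck kernel.) -/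
open MeasureTheory

/-- The standard Gaussian measure on `ℝⁿ`. -/
noncomputable def stdGaussian (n : ℕ) : Measure (EuclideanSpace ℝ (Fin n)) :=
  volume.withDensity fun x =>
    ENNReal.ofReal ((2 * Real.pi) ^ (-(n : ℝ) / 2) * Real.exp (-‖x‖ ^ 2 / 2))

open scoped RealInnerProductSpace

theorem stdGaussian_eq (n : ℕ) :
    stdGaussian n = ProbabilityTheory.stdGaussian (EuclideanSpace ℝ (Fin n)) := by
  have hpos : ∀ x : EuclideanSpace ℝ (Fin n),
      0 ≤ (2 * Real.pi) ^ (-(n : ℝ) / 2) * Real.exp (-‖x‖ ^ 2 / 2) := fun x => by positivity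
  have hInt : Integrable (fun x : EuclideanSpace ℝ (Fin n) =>
      (2 * Real.pi) ^ (-(n : ℝ) / 2) * Real.exp (-‖x‖ ^ 2 / 2)) := by
    apply Integrable.const_mul
    have := (GaussianFourier.integrable_cexp_neg_mul_sq_norm_add (b := 1 / 2) (by norm_num) 0
      (0 : EuclideanSpace ℝ (Fin n))).norm
    refine this.congr (ae_of_all _ fun x => ?_)
    simp only [Complex.norm_exp]
    congr 1
    simp [← Complex.ofReal_pow]
    norm_num
    ring
  have : IsFiniteMeasure (stdGaussian n) := by
    apply isFiniteMeasure_withDensity_ofReal hInt.2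
  apply Measure.ext_of_charFun
  ext t
  rw [ProbabilityTheory.charFun_stdGaussian, charFun_apply, stdGaussian,
    integral_withDensity_eq_integral_toReal_smul (by fun_prop) (by simp)]
  simp only [ENNReal.toReal_ofReal (hpos _)]
  have key := GaussianFourier.integral_cexp_neg_mul_sq_norm_add (b := 1 / 2) (by norm_num)
    Complex.I t
  have h2 : (Real.pi / (1 / 2) : ℂ) ^ (Module.finrank ℝ (EuclideanSpace ℝ (Fin n)) / 2 : ℂ)
      = (((2 * Real.pi) ^ ((n : ℝ) / 2) : ℝ) : ℂ) := by
    rw [Complex.ofReal_cpow (by positivity)]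
    simp
    ring_nf
  rw [h2] at key
  have h3 : ∀ x : EuclideanSpace ℝ (Fin n),
      ((2 * Real.pi) ^ (-(n : ℝ) / 2) * Real.exp (-‖x‖ ^ 2 / 2)) •
        Complex.exp (((inner ℝ x t : ℝ) : ℂ) * Complex.I) =
      (((2 * Real.pi) ^ (-(n : ℝ) / 2) : ℝ) : ℂ) *
        Complex.exp (-(1 / 2) * (‖x‖ : ℂ) ^ 2 + Complex.I * ((inner ℝ t x : ℝ) : ℂ)) := by
    intro x
    rw [Complex.exp_add, real_inner_comm, Complex.real_smul]
    push_cast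
    rw [mul_assoc, mul_comm Complex.I]
    congr 3
    ring
  simp_rw [h3]
  rw [integral_const_mul, key, ← mul_assoc, ← Complex.ofReal_mul, ← Real.rpow_add (by positivity)]
  simp
  rw [neg_div, neg_add_cancel, Real.rpow_zero]
  simp
  ring_nf

section Stability

open ProbabilityTheory

variable {F : Type*} [NormedAddCommGroup F] [NormedSpace ℝ F] [CompleteSpace F]
  [SecondCountableTopology F] [MeasurableSpace F] [BorelSpace F]

theorem map_smul_add_smul_of_isGaussian (ν : Measure F) [IsGaussian ν]
    (hν : ∀ L : StrongDual ℝ F, ∫ x, L x ∂ν = 0) (a b : ℝ) :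
    (ν.prod ν).map (fun w : F × F => a • w.1 + b • w.2) =
      ν.map (fun x => √(a ^ 2 + b ^ 2) • x) := by
  have hchar : ∀ L : StrongDual ℝ F, ∀ c : ℝ,
      charFunDual ν (c • L) = Complex.exp (-((c ^ 2 * Var[L; ν] : ℝ) : ℂ) / 2) := by
    intro L c
    rw [IsGaussian.charFunDual_eq]
    have h1 : ∫ x, (c • L) x ∂ν = 0 := hν _
    have h2 : Var[⇑(c • L); ν] = c ^ 2 * Var[L; ν] := by
      rw [← variance_const_mul]; rfl
    rw [integral_complex_ofReal, h1, h2]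
    simp
    ring_nf
  let A : F × F →L[ℝ] F := a • ContinuousLinearMap.fst ℝ F F + b • ContinuousLinearMap.snd ℝ F F
  let B : F →L[ℝ] F := √(a ^ 2 + b ^ 2) • ContinuousLinearMap.id ℝ F
  change (ν.prod ν).map A = ν.map B
  apply Measure.ext_of_charFunDual
  ext L
  rw [charFunDual_map, charFunDual_map, charFunDual_prod]
  have h1 : (L.comp A).comp (.inl ℝ F F) = a • L := by ext; simp [A]
  have h2 : (L.comp A).comp (.inr ℝ F F) = b • L := by ext; simp [A]
  have h3 : L.comp B = √(a ^ 2 + b ^ 2) • L := by ext; simp [B]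
  rw [h1, h2, h3, hchar, hchar, hchar, ← Complex.exp_add, Real.sq_sqrt (by positivity)]
  congr 1
  push_cast
  ring

end Stability

theorem rpow_le_cubic {α x : ℝ} (hα0 : 0 ≤ α) (hα1 : α ≤ 1) (hx : 0 < x) :
    x ^ α ≤ 1 + α * (x - 1) - α * (1 - α) / 2 * (x - 1) ^ 2 + |x - 1| ^ 3 := by
  have hd : ∀ k y : ℝ, 0 < y → HasDerivAt
      (fun y => 1 + α * (y - 1) - α * (1 - α) / 2 * (y - 1) ^ 2 + k * (y - 1) ^ 3 - y ^ α)
      (α * (1 - (1 - α) * (y - 1) - y ^ (α - 1)) + 3 * k * (y - 1) ^ 2) y := by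
    intro k y hy
    have h1 := (hasDerivAt_id y).sub_const 1
    have h2 := ((((h1.const_mul α).const_add 1).sub ((h1.pow 2).const_mul (α * (1 - α) / 2))).add
      ((h1.pow 3).const_mul k)).sub (Real.hasDerivAt_rpow_const (p := α) (Or.inl hy.ne'))
    refine (h2.congr_deriv ?_).congr_of_eventuallyEq (Filter.Eventually.of_forall fun z => ?_)
    · simp; ring
    · simp
  rcases le_total x 1 with h | h
  · have hanti : AntitoneOn
        (fun y => 1 + α * (y - 1) - α * (1 - α) / 2 * (y - 1) ^ 2 + 0 * (y - 1) ^ 3 - y ^ α)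
        (Set.Ioc 0 1) := by
      refine antitoneOn_of_hasDerivWithinAt_nonpos (convex_Ioc 0 1)
        (fun y hy => (hd 0 y hy.1).continuousAt.continuousWithinAt)
        (fun y hy => (hd 0 y (interior_subset hy).1).hasDerivWithinAt) fun y hy => ?_
      have hy := interior_subset hy
      have h1 : y ^ (1 - α) ≤ 1 + (1 - α) * (y - 1) := by
        have := rpow_one_add_le_one_add_mul_self (s := y - 1) (p := 1 - α)
          (by linarith [hy.1]) (by linarith) (by linarith)
        simpa using this
      have h2 : y ^ (α - 1) * y ^ (1 - α) = 1 := by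
        rw [← Real.rpow_add hy.1]; simp
      have h3 : 0 < y ^ (1 - α) := Real.rpow_pos_of_pos hy.1 _
      have h4 : 0 < y ^ (α - 1) := Real.rpow_pos_of_pos hy.1 _
      have h5 : 1 - (1 - α) * (y - 1) - y ^ (α - 1) ≤ 0 := by
        by_contra hcon
        push Not at hcon
        have := mul_lt_mul_of_pos_right hcon h3
        nlinarith [sq_nonneg ((1 - α) * (y - 1)), hy.2,
          mul_nonneg (sub_nonneg.2 hα1) (sub_nonneg.2 hy.2)]
      nlinarith
    have := hanti ⟨hx, h⟩ ⟨one_pos, le_refl 1⟩ h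
    simp at this
    have h6 : 0 ≤ |x - 1| ^ 3 := by positivity
    linarith
  · have hmono : MonotoneOn
        (fun y => 1 + α * (y - 1) - α * (1 - α) / 2 * (y - 1) ^ 2 + 1 * (y - 1) ^ 3 - y ^ α)
        (Set.Ici 1) := by
      refine monotoneOn_of_hasDerivWithinAt_nonneg (convex_Ici 1)
        (fun y hy => (hd 1 y (one_pos.trans_le hy)).continuousAt.continuousWithinAt)
        (fun y hy => (hd 1 y (one_pos.trans_le (interior_subset hy))).hasDerivWithinAt)
        fun y hy => ?_
      have hy1 : 1 ≤ y := interior_subset hy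
      have hy : 0 < y := one_pos.trans_le hy1
      have h1 : (y⁻¹) ^ (1 - α) ≤ 1 + (1 - α) * (y⁻¹ - 1) := by
        have := rpow_one_add_le_one_add_mul_self (s := y⁻¹ - 1) (p := 1 - α)
          (by linarith [inv_pos.2 hy]) (by linarith) (by linarith)
        simpa using this
      rw [Real.inv_rpow hy.le, ← Real.rpow_neg hy.le, neg_sub] at h1
      have h2 : y⁻¹ - 1 ≤ -(y - 1) + (y - 1) ^ 2 := by
        have : -(y - 1) + (y - 1) ^ 2 - (y⁻¹ - 1) = (y - 1) ^ 3 / y := by field_simp; ring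
        have : 0 ≤ (y - 1) ^ 3 / y := div_nonneg (pow_nonneg (by linarith) 3) hy.le
        linarith
      have h3 := mul_le_mul_of_nonneg_left h2 (sub_nonneg.2 hα1)
      have h4 : y ^ (α - 1) ≤ 1 - (1 - α) * (y - 1) + (y - 1) ^ 2 := by
        nlinarith [mul_nonneg hα0 (sq_nonneg (y - 1))]
      nlinarith [mul_nonneg hα0 (sub_nonneg.2 h4), mul_nonneg (sub_nonneg.2 hα1) (sq_nonneg (y - 1)),
        sq_nonneg (y - 1)]
    have := hmono (Set.self_mem_Ici) h h
    simp at this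
    rw [abs_of_nonneg (by linarith)]
    linarith

theorem cubic_mul_cubic_le {α β c d δ X Y e e' H : ℝ} (hα0 : 0 ≤ α) (hα1 : α ≤ 1)
    (hβ0 : 0 ≤ β) (hβ1 : β ≤ 1) (hc0 : 0 ≤ c) (hc1 : c ≤ 1) (hd0 : 0 ≤ d) (hd1 : d ≤ 1)
    (hδ0 : 0 ≤ δ) (hδ1 : δ ≤ 1) (hH : 1 ≤ H) (hX : |X| ≤ H) (hY : |Y| ≤ H) (he : |e| ≤ H)
    (he' : |e'| ≤ H) (hX' : |X + δ * e| ≤ H) (hY' : |Y + δ * e'| ≤ H) :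
    (1 + α * (δ * (X + δ * e)) - c * (δ * (X + δ * e)) ^ 2 + |δ * (X + δ * e)| ^ 3) *
      (1 + β * (δ * (Y + δ * e')) - d * (δ * (Y + δ * e')) ^ 2 + |δ * (Y + δ * e')| ^ 3) ≤
    1 + α * (δ * (X + δ * e)) + β * (δ * (Y + δ * e')) +
      δ ^ 2 * (-c * X ^ 2 + α * β * (X * Y) - d * Y ^ 2) + 20 * (δ ^ 3 * H ^ 6) := by
  set S := X + δ * e with hS
  set T := Y + δ * e' with hT
  have hH0 : 0 ≤ H := by linarith
  have key : ∀ k y : ℝ, ∀ i j : ℕ, |k| ≤ 1 → |y| ≤ H ^ i → i ≤ 6 →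
      k * δ ^ (3 + j) * y ≤ δ ^ 3 * H ^ 6 := by
    intro k y i j hk hy hi
    calc k * δ ^ (3 + j) * y ≤ |k * δ ^ (3 + j) * y| := le_abs_self _
      _ = |k| * δ ^ (3 + j) * |y| := by rw [abs_mul, abs_mul, abs_of_nonneg (pow_nonneg hδ0 _)]
      _ ≤ 1 * δ ^ 3 * H ^ 6 := by
        gcongr ?_ * ?_ * ?_
        · exact pow_le_pow_of_le_one hδ0 hδ1 (by omega)
        · exact hy.trans (pow_le_pow_right₀ hH hi)
      _ = _ := by ring
  have habs : ∀ z : ℝ, 0 ≤ z → z ≤ 1 → |z| ≤ 1 := fun z h0 h1 => by rwa [abs_of_nonneg h0]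
  have hneg : ∀ z : ℝ, 0 ≤ z → z ≤ 1 → |-z| ≤ 1 := fun z h0 h1 => by rwa [abs_neg, abs_of_nonneg h0]
  have hmul : ∀ y z : ℝ, ∀ i j : ℕ, |y| ≤ H ^ i → |z| ≤ H ^ j → |y * z| ≤ H ^ (i + j) := by
    intro y z i j hy hz
    rw [abs_mul, pow_add]
    exact mul_le_mul hy hz (abs_nonneg _) (pow_nonneg hH0 _)
  have hX1 : |X| ≤ H ^ 1 := by simpa using hX
  have hY1 : |Y| ≤ H ^ 1 := by simpa using hY
  have he1 : |e| ≤ H ^ 1 := by simpa using he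
  have he1' : |e'| ≤ H ^ 1 := by simpa using he'
  have hS1 : |S| ≤ H ^ 1 := by simpa using hX'
  have hT1 : |T| ≤ H ^ 1 := by simpa using hY'
  have hS2 : |S ^ 2| ≤ H ^ 2 := by rw [abs_pow]; gcongr
  have hT2 : |T ^ 2| ≤ H ^ 2 := by rw [abs_pow]; gcongr
  have hS3 : |(|S| ^ 3)| ≤ H ^ 3 := by rw [abs_pow, abs_abs]; gcongr
  have hT3 : |(|T| ^ 3)| ≤ H ^ 3 := by rw [abs_pow, abs_abs]; gcongr
  have hab : α * β ≤ 1 := mul_le_one₀ hα1 hβ0 hβ1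
  have k1 := key 1 _ _ 0 (by simp) hS3 (by norm_num)
  have k2 := key 1 _ _ 0 (by simp) hT3 (by norm_num)
  have k3 := key α _ _ 1 (habs _ hα0 hα1) (hmul _ _ _ _ hS1 hT3) (by norm_num)
  have k4 := key β _ _ 1 (habs _ hβ0 hβ1) (hmul _ _ _ _ hS3 hT1) (by norm_num)
  have k5 := key (-(α * d)) _ _ 0 (hneg _ (by positivity) (mul_le_one₀ hα1 hd0 hd1))
    (hmul _ _ _ _ hS1 hT2) (by norm_num)
  have k6 := key (-(c * β)) _ _ 0 (hneg _ (by positivity) (mul_le_one₀ hc1 hβ0 hβ1))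
    (hmul _ _ _ _ hS2 hT1) (by norm_num)
  have k7 := key (c * d) _ _ 1 (habs _ (by positivity) (mul_le_one₀ hc1 hd0 hd1))
    (hmul _ _ _ _ hS2 hT2) (by norm_num)
  have k8 := key (-c) _ _ 2 (hneg _ hc0 hc1) (hmul _ _ _ _ hS2 hT3) (by norm_num)
  have k9 := key (-d) _ _ 2 (hneg _ hd0 hd1) (hmul _ _ _ _ hS3 hT2) (by norm_num)
  have k10 := key 1 _ _ 3 (by simp) (hmul _ _ _ _ hS3 hT3) (by norm_num)
  have k11 := key (-c) _ _ 0 (hneg _ hc0 hc1) (hmul _ _ _ _ he1 hX1) (by norm_num)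
  have k12 := key (-c) _ _ 0 (hneg _ hc0 hc1) (hmul _ _ _ _ he1 hS1) (by norm_num)
  have k13 := key (-d) _ _ 0 (hneg _ hd0 hd1) (hmul _ _ _ _ he1' hY1) (by norm_num)
  have k14 := key (-d) _ _ 0 (hneg _ hd0 hd1) (hmul _ _ _ _ he1' hT1) (by norm_num)
  have k15 := key (α * β) _ _ 0 (habs _ (by positivity) hab) (hmul _ _ _ _ he1 hT1) (by norm_num)
  have k16 := key (α * β) _ _ 0 (habs _ (by positivity) hab) (hmul _ _ _ _ hX1 he1') (by norm_num)
  have q1 : -c * (δ * S) ^ 2 = -c * δ ^ 2 * X ^ 2 + -c * δ ^ (3 + 0) * (e * X)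
      + -c * δ ^ (3 + 0) * (e * S) := by rw [hS]; ring
  have q2 : -d * (δ * T) ^ 2 = -d * δ ^ 2 * Y ^ 2 + -d * δ ^ (3 + 0) * (e' * Y)
      + -d * δ ^ (3 + 0) * (e' * T) := by rw [hT]; ring
  have q3 : α * β * (δ * S) * (δ * T) = α * β * δ ^ 2 * (X * Y) + α * β * δ ^ (3 + 0) * (e * T)
      + α * β * δ ^ (3 + 0) * (X * e') := by rw [hS, hT]; ring
  have hHp : 0 ≤ δ ^ 3 * H ^ 6 := by positivity
  rw [abs_mul, abs_mul, abs_of_nonneg hδ0]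
  clear_value S T
  have expand : (1 + α * (δ * S) - c * (δ * S) ^ 2 + (δ * |S|) ^ 3) *
      (1 + β * (δ * T) - d * (δ * T) ^ 2 + (δ * |T|) ^ 3) =
      1 + α * (δ * S) + β * (δ * T) +
      (1 * δ ^ (3 + 0) * |S| ^ 3) + (1 * δ ^ (3 + 0) * |T| ^ 3) +
      (α * δ ^ (3 + 1) * (S * |T| ^ 3)) + (β * δ ^ (3 + 1) * (|S| ^ 3 * T)) +
      (-(α * d) * δ ^ (3 + 0) * (S * T ^ 2)) + (-(c * β) * δ ^ (3 + 0) * (S ^ 2 * T)) +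
      (c * d * δ ^ (3 + 1) * (S ^ 2 * T ^ 2)) + (-c * δ ^ (3 + 2) * (S ^ 2 * |T| ^ 3)) +
      (-d * δ ^ (3 + 2) * (|S| ^ 3 * T ^ 2)) + (1 * δ ^ (3 + 3) * (|S| ^ 3 * |T| ^ 3)) +
      (-c * (δ * S) ^ 2) + (-d * (δ * T) ^ 2) +
      (α * β * (δ * S) * (δ * T)) := by
    ring
  rw [expand, q1, q2, q3]
  linarith

section TaylorBounds

set_option linter.unusedSectionVars false

variable {E : Type*} [NormedAddCommGroup E] [InnerProductSpace ℝ E] [FiniteDimensional ℝ E]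
  [MeasurableSpace E] [BorelSpace E]

/-- `u` takes values in `[m, M]`, is `K`-Lipschitz, and has first order Taylor expansions with
gradient `g`, bounded by `K`, and quadratic remainder with constant `L`. -/
structure HasTaylorBounds (u : E → ℝ) (g : E → E) (m M K L : ℝ) : Prop where
  lower : ∀ x, m ≤ u x
  upper : ∀ x, u x ≤ M
  measurable_grad : Measurable g
  norm_grad_le : ∀ x, ‖g x‖ ≤ K
  lipschitz : ∀ x y, |u y - u x| ≤ K * ‖y - x‖
  nonneg : 0 ≤ L
  taylor : ∀ x y, |u y - u x - ⟪g x, y - x⟫| ≤ L * ‖y - x‖ ^ 2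

namespace HasTaylorBounds

variable {u : E → ℝ} {g : E → E} {m M K L : ℝ}

theorem continuous (h : HasTaylorBounds u g m M K L) : Continuous u :=
  (LipschitzWith.of_dist_le_mul (K := K.toNNReal) fun x y => by
    rw [Real.dist_eq, dist_eq_norm, Real.coe_toNNReal _ ((norm_nonneg _).trans (h.norm_grad_le 0))]
    exact h.lipschitz y x).continuous

theorem integrable_comp (h : HasTaylorBounds u g m M K L) {Ω : Type*} [MeasurableSpace Ω]
    {P : Measure Ω} [IsFiniteMeasure P] {Y : Ω → E} (hY : Measurable Y) :
    Integrable (fun ω => u (Y ω)) P :=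
  .of_bound (h.continuous.measurable.comp hY).aestronglyMeasurable (max |m| |M|)
    (ae_of_all _ fun _ => abs_le_max_abs_abs (h.lower _) (h.upper _))

theorem average (h : HasTaylorBounds u g m M K L) (ν : Measure E) [IsProbabilityMeasure ν]
    {c : ℝ} (hc : |c| ≤ 1) (d : ℝ) :
    HasTaylorBounds (fun s => ∫ y, u (c • s + d • y) ∂ν)
      (fun s => c • ∫ y, g (c • s + d • y) ∂ν) m M K L := by
  have hInt : ∀ s, Integrable (fun y => u (c • s + d • y)) ν := fun s =>
    h.integrable_comp (by fun_prop)
  have hgint : ∀ s, Integrable (fun y => g (c • s + d • y)) ν := fun s =>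
    .of_bound (h.measurable_grad.comp (by fun_prop)).aestronglyMeasurable K
      (ae_of_all _ fun _ => h.norm_grad_le _)
  have hK : 0 ≤ K := (norm_nonneg _).trans (h.norm_grad_le 0)
  have hdiff : ∀ x y z : E, (c • y + d • z) - (c • x + d • z) = c • (y - x) := fun x y z => by
    rw [add_sub_add_right_eq_sub, smul_sub]
  have hnorm : ∀ x y : E, ‖c • (y - x)‖ ≤ ‖y - x‖ := fun x y => by
    rw [norm_smul, Real.norm_eq_abs]
    exact mul_le_of_le_one_left (norm_nonneg _) hc
  have hbound : ∀ (f : E → ℝ) (C : ℝ), (∀ y, |f y| ≤ C) → |∫ y, f y ∂ν| ≤ C := fun f C hf => by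
    simpa using norm_integral_le_of_norm_le_const (μ := ν) (f := f) (ae_of_all _ hf)
  refine ⟨fun s => ?_, fun s => ?_, ?_, fun s => ?_, fun x y => ?_, h.nonneg, fun x y => ?_⟩
  · simpa using integral_mono (integrable_const m) (hInt s) fun _ => h.lower _
  · simpa using integral_mono (hInt s) (integrable_const M) fun _ => h.upper _
  · have : Measurable (Function.uncurry fun s y => g (c • s + d • y)) :=
      h.measurable_grad.comp (by fun_prop)
    exact (this.stronglyMeasurable.integral_prod_right).measurable.const_smul c
  · rw [norm_smul, Real.norm_eq_abs]
    refine (mul_le_of_le_one_left (norm_nonneg _) hc).trans ?_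
    simpa using norm_integral_le_of_norm_le_const (μ := ν)
      (ae_of_all _ fun y => h.norm_grad_le (c • s + d • y))
  · rw [← integral_sub (hInt y) (hInt x)]
    refine hbound _ _ fun z => (h.lipschitz _ _).trans ?_
    rw [hdiff]
    exact mul_le_mul_of_nonneg_left (hnorm x y) hK
  · rw [real_inner_smul_left, ← real_inner_smul_right, real_inner_comm, ← integral_inner (hgint x),
      ← integral_sub (hInt y) (hInt x)]
    have hsub : Integrable (fun z => u (c • y + d • z) - u (c • x + d • z)) ν :=
      (hInt y).sub (hInt x)
    rw [← integral_sub hsub ((hgint x).const_inner _)]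
    refine hbound _ _ fun z => ?_
    have := h.taylor (c • x + d • z) (c • y + d • z)
    rw [hdiff, real_inner_comm] at this
    refine this.trans ?_
    gcongr
    · exact h.nonneg
    · exact hnorm x y

theorem comp_contDiff (h : HasTaylorBounds u g m M K L) {θ : ℝ → ℝ} {m' M' : ℝ}
    (hθ : ∀ t ∈ Set.Icc m M, ContDiffAt ℝ 2 θ t) (hm : ∀ t ∈ Set.Icc m M, m' ≤ θ t)
    (hM : ∀ t ∈ Set.Icc m M, θ t ≤ M') :
    ∃ g' K' L', HasTaylorBounds (fun x => θ (u x)) g' m' M' K' L' := by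
  have hmem : ∀ x, u x ∈ Set.Icc m M := fun x => ⟨h.lower x, h.upper x⟩
  have hK : 0 ≤ K := (norm_nonneg _).trans (h.norm_grad_le 0)
  have hd1 : ∀ t ∈ Set.Icc m M, ContDiffAt ℝ 1 (deriv θ) t := fun t ht =>
    (hθ t ht).derivWithin (m := 1) (by norm_num)
  have hd2 : ∀ t ∈ Set.Icc m M, ContinuousAt (deriv (deriv θ)) t := fun t ht => by
    exact ((hd1 t ht).derivWithin (m := 0) (by norm_num)).continuousAt
  obtain ⟨C₁, hC₁⟩ := isCompact_Icc.exists_bound_of_continuousOn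
    (fun t ht => (hd1 t ht).continuousAt.continuousWithinAt)
  obtain ⟨C₂, hC₂⟩ := isCompact_Icc.exists_bound_of_continuousOn
    (fun t ht => (hd2 t ht).continuousWithinAt)
  have hC₁0 : 0 ≤ C₁ := (norm_nonneg _).trans (hC₁ _ (hmem 0))
  have hC₂0 : 0 ≤ C₂ := (norm_nonneg _).trans (hC₂ _ (hmem 0))
  have hlip : ∀ a ∈ Set.Icc m M, ∀ b ∈ Set.Icc m M, |θ b - θ a| ≤ C₁ * |b - a| :=
    fun a ha b hb => (convex_Icc m M).norm_image_sub_le_of_norm_deriv_le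
      (fun t ht => (hθ t ht).differentiableAt (by norm_num)) hC₁ ha hb
  have hlip' : ∀ a ∈ Set.Icc m M, ∀ b ∈ Set.Icc m M, |deriv θ b - deriv θ a| ≤ C₂ * |b - a| :=
    fun a ha b hb => (convex_Icc m M).norm_image_sub_le_of_norm_deriv_le
      (fun t ht => (hd1 t ht).differentiableAt (by norm_num)) hC₂ ha hb
  have htay : ∀ a ∈ Set.Icc m M, ∀ b ∈ Set.Icc m M,
      |θ b - θ a - deriv θ a * (b - a)| ≤ C₂ * |b - a| ^ 2 := by
    intro a ha b hb
    have hsub : Set.uIcc a b ⊆ Set.Icc m M := Set.uIcc_subset_Icc ha hb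
    have := (convex_uIcc a b).norm_image_sub_le_of_norm_hasDerivWithin_le
      (f := fun t => θ t - deriv θ a * t) (f' := fun t => deriv θ t - deriv θ a)
      (C := C₂ * |b - a|) (x := a) (y := b)
      (fun t ht => (by
        have := ((hθ t (hsub ht)).differentiableAt (by norm_num)).hasDerivAt.sub
          ((hasDerivAt_id t).const_mul (deriv θ a))
        simpa [Pi.sub_def] using this.hasDerivWithinAt))
      (fun t ht => (hlip' a ha t (hsub ht)).trans
        (mul_le_mul_of_nonneg_left (Set.abs_sub_left_of_mem_uIcc ht) hC₂0))
      Set.left_mem_uIcc Set.right_mem_uIcc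
    rw [Real.norm_eq_abs, Real.norm_eq_abs] at this
    calc _ = |θ b - deriv θ a * b - (θ a - deriv θ a * a)| := by ring_nf
      _ ≤ _ := this
      _ = _ := by ring
  refine ⟨fun x => deriv θ (u x) • g x, C₁ * K, C₂ * K ^ 2 + C₁ * L, fun x => hm _ (hmem x),
    fun x => hM _ (hmem x), ?_, fun x => ?_, fun x y => ?_, ?_, fun x y => ?_⟩
  · exact ((measurable_deriv θ).comp h.continuous.measurable).smul h.measurable_grad
  · rw [norm_smul]
    exact mul_le_mul (hC₁ _ (hmem x)) (h.norm_grad_le x) (norm_nonneg _) hC₁0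
  · calc _ ≤ C₁ * |u y - u x| := hlip _ (hmem x) _ (hmem y)
      _ ≤ C₁ * (K * ‖y - x‖) := mul_le_mul_of_nonneg_left (h.lipschitz x y) hC₁0
      _ = _ := by ring
  · have := h.nonneg
    positivity
  · rw [real_inner_smul_left]
    have h1 := htay _ (hmem x) _ (hmem y)
    have h2 : |deriv θ (u x) * (u y - u x - ⟪g x, y - x⟫)| ≤ C₁ * (L * ‖y - x‖ ^ 2) := by
      rw [abs_mul]
      exact mul_le_mul (hC₁ _ (hmem x)) (h.taylor x y) (abs_nonneg _) hC₁0
    have h3 : C₂ * |u y - u x| ^ 2 ≤ C₂ * (K * ‖y - x‖) ^ 2 := by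
      gcongr
      exact h.lipschitz x y
    calc _ = |(θ (u y) - θ (u x) - deriv θ (u x) * (u y - u x)) +
          deriv θ (u x) * (u y - u x - ⟪g x, y - x⟫)| := by ring_nf
      _ ≤ _ := abs_add_le _ _
      _ ≤ C₂ * (K * ‖y - x‖) ^ 2 + C₁ * (L * ‖y - x‖ ^ 2) := add_le_add (h1.trans h3) h2
      _ = _ := by ring

end HasTaylorBounds

theorem exists_hasTaylorBounds_of_hasCompactSupport {h : E → ℝ} (hc : HasCompactSupport h)
    (hd : ContDiff ℝ 2 h) : ∃ g m M K L, HasTaylorBounds h g m M K L := by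
  obtain ⟨C₀, hC₀⟩ := hc.exists_bound_of_continuous hd.continuous
  have hd1 : ContDiff ℝ 1 (fderiv ℝ h) := hd.fderiv_right (by norm_num)
  have hc1 : HasCompactSupport (fderiv ℝ h) := hc.fderiv (𝕜 := ℝ)
  obtain ⟨C₁, hC₁⟩ := hc1.exists_bound_of_continuous hd1.continuous
  obtain ⟨C₂, hC₂⟩ := hd1.lipschitzWith_of_hasCompactSupport hc1 (by norm_num)
  refine ⟨fun x => (InnerProductSpace.toDual ℝ E).symm (fderiv ℝ h x), -C₀, C₀, C₁, C₂,
    fun x => (abs_le.1 (hC₀ x)).1, fun x => (abs_le.1 (hC₀ x)).2, ?_, fun x => ?_, fun x y => ?_,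
    C₂.2, fun x y => ?_⟩
  · exact ((InnerProductSpace.toDual ℝ E).symm.continuous.comp hd1.continuous).measurable
  · simpa using hC₁ x
  · exact convex_univ.norm_image_sub_le_of_norm_fderiv_le
      (fun t _ => hd.differentiable (by norm_num) t) (fun t _ => hC₁ t) trivial trivial
  · rw [InnerProductSpace.toDual_symm_apply]
    have := (convex_segment x y).norm_image_sub_le_of_norm_hasFDerivWithin_le' (f := h)
      (f' := fderiv ℝ h) (φ := fderiv ℝ h x) (C := C₂ * ‖y - x‖) (x := x) (y := y)
      (fun t _ => (hd.differentiable (by norm_num) t).hasFDerivAt.hasFDerivWithinAt)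
      (fun t ht => by
        have h1 := hC₂.dist_le_mul t x
        rw [dist_eq_norm, dist_eq_norm] at h1
        refine h1.trans (mul_le_mul_of_nonneg_left ?_ C₂.2)
        simpa [dist_eq_norm, norm_sub_rev] using (segment_subset_closedBall_left x y) ht)
      (left_mem_segment ℝ x y) (right_mem_segment ℝ x y)
    rw [Real.norm_eq_abs] at this
    exact this.trans_eq (by ring)

end TaylorBounds

theorem quadratic_form_nonpos {α β ρ P Q R : ℝ} (hα0 : 0 ≤ α) (hα1 : α ≤ 1) (hβ0 : 0 ≤ β)
    (hβ1 : β ≤ 1) (hρ : 0 ≤ ρ) (h : ρ ^ 2 * (α * β) ≤ (1 - α) * (1 - β))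
    (hR : R ≤ P * Q) :
    -(α * (1 - α) / 2) * P ^ 2 + α * β * (ρ * R) - β * (1 - β) / 2 * Q ^ 2 ≤ 0 := by
  have hα : 0 ≤ 1 - α := by linarith
  have hβ : 0 ≤ 1 - β := by linarith
  have h1 : 2 * (α * β * ρ * (P * Q)) ≤ α * (1 - α) * P ^ 2 + β * (1 - β) * Q ^ 2 := by
    refine abs_le_of_sq_le_sq' ?_ (by positivity) |>.2
    have h2 := mul_le_mul_of_nonneg_left h (by positivity : 0 ≤ 4 * (α * β) * (P * Q) ^ 2)
    nlinarith [sq_nonneg (α * (1 - α) * P ^ 2 - β * (1 - β) * Q ^ 2)]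
  have h3 : α * β * (ρ * R) ≤ α * β * (ρ * (P * Q)) := by gcongr
  linarith

section Gaussian

set_option linter.unusedSectionVars false

open ProbabilityTheory (IsGaussian)

variable {E : Type*} [NormedAddCommGroup E] [InnerProductSpace ℝ E] [FiniteDimensional ℝ E]
  [MeasurableSpace E] [BorelSpace E]

local notation "γ" => ProbabilityTheory.stdGaussian E

local notation "γ₂" => Measure.prod γ γ

theorem measurePreserving_stdGaussian_rotation {ρ σ : ℝ} (h : ρ ^ 2 + σ ^ 2 = 1) :
    MeasurePreserving (fun w : E × E => ρ • w.1 + σ • w.2) γ₂ γ := by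
  refine ⟨by fun_prop, ?_⟩
  rw [map_smul_add_smul_of_isGaussian γ ProbabilityTheory.integral_strongDual_stdGaussian, h]
  simp

theorem integral_inner_stdGaussian (v : E) : ∫ x, ⟪v, x⟫ ∂γ = 0 :=
  ProbabilityTheory.integral_strongDual_stdGaussian (innerSL ℝ v)

theorem memLp_inner_stdGaussian (v : E) : MemLp (fun x => ⟪v, x⟫) 2 γ :=
  IsGaussian.memLp_dual γ (innerSL ℝ v) 2 (by simp)

theorem integral_inner_mul_inner_stdGaussian (v w : E) : ∫ x, ⟪v, x⟫ * ⟪w, x⟫ ∂γ = ⟪v, w⟫ := by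
  have h := ProbabilityTheory.covarianceBilin_apply (μ := γ) IsGaussian.memLp_two_id v w
  rw [ProbabilityTheory.covarianceBilin_stdGaussian] at h
  simp at h
  exact h.symm

theorem integral_comp_rotation {ρ σ : ℝ} (h : ρ ^ 2 + σ ^ 2 = 1) {f : E → ℝ} (hf : Continuous f) :
    ∫ w, f (ρ • w.1 + σ • w.2) ∂γ₂ = ∫ x, f x ∂γ := by
  have hmp := measurePreserving_stdGaussian_rotation (E := E) h
  conv_rhs => rw [← hmp.map_eq]
  exact (integral_map hmp.measurable.aemeasurable hf.aestronglyMeasurable).symm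

theorem integral_inner_sq_stdGaussian (v : E) : ∫ x, ⟪v, x⟫ ^ 2 ∂γ = ‖v‖ ^ 2 := by
  simp_rw [sq, integral_inner_mul_inner_stdGaussian, real_inner_self_eq_norm_mul_norm]

theorem integral_inner_rotation_mul_inner (ρ σ : ℝ) (v w : E) :
    ∫ z, ⟪v, ρ • z.1 + σ • z.2⟫ * ⟪w, z.1⟫ ∂γ₂ = ρ * ⟪v, w⟫ := by
  have h1 : Integrable (fun z : E × E => ρ * (⟪v, z.1⟫ * ⟪w, z.1⟫)) γ₂ :=
    (((memLp_inner_stdGaussian v).integrable_mul (memLp_inner_stdGaussian w)).comp_fst γ).const_mul ρ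
  have h2 : Integrable (fun z : E × E => σ * (⟪w, z.1⟫ * ⟪v, z.2⟫)) γ₂ :=
    (((memLp_inner_stdGaussian w).integrable (by norm_num)).mul_prod
      ((memLp_inner_stdGaussian v).integrable (by norm_num))).const_mul σ
  have h3 : ∀ z : E × E, ⟪v, ρ • z.1 + σ • z.2⟫ * ⟪w, z.1⟫ =
      ρ * (⟪v, z.1⟫ * ⟪w, z.1⟫) + σ * (⟪w, z.1⟫ * ⟪v, z.2⟫) := fun z => by
    rw [inner_add_right, real_inner_smul_right, real_inner_smul_right]; ring
  simp_rw [h3]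
  rw [integral_add h1 h2, integral_const_mul, integral_const_mul,
    integral_prod_mul (fun x => ⟪w, x⟫) (fun x => ⟪v, x⟫), integral_inner_stdGaussian,
    integral_fun_fst (fun x : E => ⟪v, x⟫ * ⟪w, x⟫), integral_inner_mul_inner_stdGaussian]
  simp

theorem integrable_one_add_norm_add_norm_pow (k : ℕ) :
    Integrable (fun w : E × E => (1 + ‖w.1‖ + ‖w.2‖) ^ k) γ₂ := by
  have h : MemLp (fun x : E => ‖x‖) k γ := (IsGaussian.memLp_id γ k (by simp)).norm
  have := (((memLp_const (1 : ℝ)).add (h.comp_fst γ)).add (h.comp_snd γ)).integrable_norm_pow'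
  refine this.congr (ae_of_all _ fun w => ?_)
  simp only [Pi.add_apply, Real.norm_eq_abs]
  rw [abs_of_nonneg (by positivity)]

theorem HasTaylorBounds.abs_sub_average_le {u : E → ℝ} {g : E → E} {m M K L : ℝ}
    (h : HasTaylorBounds u g m M K L) (δ : ℝ) (s y : E) :
    |u (s + δ • y) - ∫ x, u (s + δ • x) ∂γ - δ * ⟪g s, y⟫| ≤
      δ ^ 2 * (L * (‖y‖ ^ 2 + ∫ x, ‖x‖ ^ 2 ∂γ)) := by
  have hpt : ∀ x, |u (s + δ • x) - u s - δ * ⟪g s, x⟫| ≤ L * δ ^ 2 * ‖x‖ ^ 2 := fun x => by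
    have := h.taylor s (s + δ • x)
    simp only [add_sub_cancel_left, real_inner_smul_right, norm_smul, mul_pow, Real.norm_eq_abs,
      sq_abs] at this
    linarith
  have hInt : Integrable (fun x => u (s + δ • x)) γ := h.integrable_comp (by fun_prop)
  have hin : Integrable (fun x => δ * ⟪g s, x⟫) γ :=
    ((memLp_inner_stdGaussian (g s)).integrable (by norm_num)).const_mul δ
  have hsq : Integrable (fun x : E => ‖x‖ ^ 2) γ := IsGaussian.memLp_two_id.integrable_norm_pow'
  have hsub : Integrable (fun x => u (s + δ • x) - u s) γ := hInt.sub (integrable_const _)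
  have havg : |(∫ x, u (s + δ • x) ∂γ) - u s| ≤ L * δ ^ 2 * ∫ x, ‖x‖ ^ 2 ∂γ := by
    have h1 : (∫ x, u (s + δ • x) ∂γ) - u s = ∫ x, (u (s + δ • x) - u s - δ * ⟪g s, x⟫) ∂γ := by
      rw [integral_sub hsub hin, integral_sub hInt (integrable_const _),
        integral_const_mul, integral_inner_stdGaussian]
      simp
    rw [h1, ← integral_const_mul]
    exact (abs_integral_le_integral_abs).trans (integral_mono
      (hsub.sub hin).abs (hsq.const_mul _) hpt)
  have h2 := hpt y
  rw [abs_le] at h2 havg ⊢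
  constructor <;> nlinarith

theorem HasTaylorBounds.le_average {u : E → ℝ} {g : E → E} {m M K L : ℝ}
    (h : HasTaylorBounds u g m M K L) (δ : ℝ) (s : E) : m ≤ ∫ x, u (s + δ • x) ∂γ := by
  simpa using (h.average γ (c := 1) (by simp) δ).lower s

theorem HasTaylorBounds.average_le {u : E → ℝ} {g : E → E} {m M K L : ℝ}
    (h : HasTaylorBounds u g m M K L) (δ : ℝ) (s : E) : ∫ x, u (s + δ • x) ∂γ ≤ M := by
  simpa using (h.average γ (c := 1) (by simp) δ).upper s

/-- First order expansion of `u` around its average, in relative terms. -/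
theorem HasTaylorBounds.exists_div_average_eq {u : E → ℝ} {g : E → E} {m M K L δ W : ℝ}
    (h : HasTaylorBounds u g m M K L) (hm : 0 < m) (hδ0 : 0 < δ) (hδ1 : δ ≤ 1) (s y : E)
    (hW : 1 ≤ W) (hy : ‖y‖ ≤ W) :
    ∃ e : ℝ,
      u (s + δ • y) / (∫ x, u (s + δ • x) ∂γ) - 1 =
        δ * (⟪g s, y⟫ / (∫ x, u (s + δ • x) ∂γ) + δ * e) ∧
      |⟪g s, y⟫ / (∫ x, u (s + δ • x) ∂γ)| ≤
        (1 + (K + L * (1 + ∫ x : E, ‖x‖ ^ 2 ∂γ)) / m) * W ^ 2 ∧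
      |e| ≤ (1 + (K + L * (1 + ∫ x : E, ‖x‖ ^ 2 ∂γ)) / m) * W ^ 2 ∧
      |⟪g s, y⟫ / (∫ x, u (s + δ • x) ∂γ) + δ * e| ≤
        (1 + (K + L * (1 + ∫ x : E, ‖x‖ ^ 2 ∂γ)) / m) * W ^ 2 := by
  have hK : 0 ≤ K := (norm_nonneg _).trans (h.norm_grad_le 0)
  have hL : 0 ≤ L := h.nonneg
  have ha := h.le_average δ s
  have hexp := h.abs_sub_average_le δ s y
  have hm₂ : 0 ≤ ∫ x : E, ‖x‖ ^ 2 ∂γ := integral_nonneg fun x => by positivity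
  generalize (∫ x : E, ‖x‖ ^ 2 ∂γ) = m₂ at *
  generalize (∫ x, u (s + δ • x) ∂γ) = a at *
  have ha0 : 0 < a := hm.trans_le ha
  have hX : |⟪g s, y⟫ / a| ≤ K / m * W ^ 2 := by
    rw [abs_div, abs_of_pos ha0, div_mul_eq_mul_div]
    gcongr
    calc |⟪g s, y⟫| ≤ ‖g s‖ * ‖y‖ := abs_real_inner_le_norm _ _
      _ ≤ K * W := by gcongr; exact h.norm_grad_le s
      _ ≤ K * W ^ 2 := by gcongr; nlinarith
  have he : |(u (s + δ • y) - a - δ * ⟪g s, y⟫) / (a * δ ^ 2)| ≤ L * (1 + m₂) / m * W ^ 2 := by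
    rw [abs_div, abs_of_pos (by positivity : 0 < a * δ ^ 2), div_le_iff₀ (by positivity)]
    calc _ ≤ δ ^ 2 * (L * (‖y‖ ^ 2 + m₂)) := hexp
      _ ≤ δ ^ 2 * (L * (W ^ 2 + m₂ * W ^ 2)) := by
        gcongr
        exact le_mul_of_one_le_right hm₂ (one_le_pow₀ hW)
      _ = L * (1 + m₂) / m * W ^ 2 * (m * δ ^ 2) := by field_simp
      _ ≤ _ := by gcongr
  have hsum : K / m * W ^ 2 + L * (1 + m₂) / m * W ^ 2 ≤ (1 + (K + L * (1 + m₂)) / m) * W ^ 2 := by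
    rw [add_div]; nlinarith [sq_nonneg W]
  have h1 : 0 ≤ K / m * W ^ 2 := by positivity
  have h2 : 0 ≤ L * (1 + m₂) / m * W ^ 2 := by positivity
  refine ⟨(u (s + δ • y) - a - δ * ⟪g s, y⟫) / (a * δ ^ 2), by field_simp; ring, by linarith,
    by linarith, ?_⟩
  refine (abs_add_le _ _).trans ?_
  rw [abs_mul, abs_of_pos hδ0]
  have := mul_le_of_le_one_left
    (abs_nonneg ((u (s + δ • y) - a - δ * ⟪g s, y⟫) / (a * δ ^ 2))) hδ1
  linarith

theorem HasTaylorBounds.rpow_mul_rpow_le {u v : E → ℝ} {g k : E → E} {m M K L δ W α β a b : ℝ}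
    (hu : HasTaylorBounds u g m M K L) (hv : HasTaylorBounds v k m M K L)
    (hα0 : 0 ≤ α) (hα1 : α ≤ 1) (hβ0 : 0 ≤ β) (hβ1 : β ≤ 1) (hm : 0 < m)
    (hδ0 : 0 < δ) (hδ1 : δ ≤ 1) (s t y z : E) (hW : 1 ≤ W) (hy : ‖y‖ ≤ W) (hz : ‖z‖ ≤ W)
    (ha : a = ∫ x, u (s + δ • x) ∂γ) (hb : b = ∫ x, v (t + δ • x) ∂γ) :
    u (s + δ • y) ^ α * v (t + δ • z) ^ β ≤
      a ^ α * b ^ β * (1 + α * (u (s + δ • y) / a - 1) + β * (v (t + δ • z) / b - 1) +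
        δ ^ 2 * (-(α * (1 - α) / 2) * (⟪g s, y⟫ / a) ^ 2 +
          α * β * (⟪g s, y⟫ / a * (⟪k t, z⟫ / b)) - β * (1 - β) / 2 * (⟪k t, z⟫ / b) ^ 2) +
        20 * (δ ^ 3 * ((1 + (K + L * (1 + ∫ x : E, ‖x‖ ^ 2 ∂γ)) / m) * W ^ 2) ^ 6)) := by
  have hK : 0 ≤ K := (norm_nonneg _).trans (hu.norm_grad_le 0)
  have hL : 0 ≤ L := hu.nonneg
  obtain ⟨e, he1, he2, he3, he4⟩ := hu.exists_div_average_eq hm hδ0 hδ1 s y hW hy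
  obtain ⟨e', he1', he2', he3', he4'⟩ := hv.exists_div_average_eq hm hδ0 hδ1 t z hW hz
  have ha0 := hm.trans_le (hu.le_average δ s)
  have hb0 := hm.trans_le (hv.le_average δ t)
  rw [← ha] at he1 he2 he4 ha0
  rw [← hb] at he1' he2' he4' hb0
  have hm₂ : 0 ≤ ∫ x : E, ‖x‖ ^ 2 ∂γ := integral_nonneg fun x => by positivity
  generalize (∫ x : E, ‖x‖ ^ 2 ∂γ) = m₂ at *
  have hH : 1 ≤ (1 + (K + L * (1 + m₂)) / m) * W ^ 2 := by
    have : 0 ≤ (K + L * (1 + m₂)) / m := by positivity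
    exact one_le_mul_of_one_le_of_one_le (by linarith) (one_le_pow₀ hW)
  have hApos : 0 < u (s + δ • y) := hm.trans_le (hu.lower _)
  have hBpos : 0 < v (t + δ • z) := hm.trans_le (hv.lower _)
  have hc : ∀ r : ℝ, 0 ≤ r → r ≤ 1 → 0 ≤ r * (1 - r) / 2 ∧ r * (1 - r) / 2 ≤ 1 := fun r h0 h1 =>
    ⟨by have := mul_nonneg h0 (sub_nonneg.2 h1); linarith, by nlinarith⟩
  have hA := rpow_le_cubic hα0 hα1 (div_pos hApos ha0)
  have hB := rpow_le_cubic hβ0 hβ1 (div_pos hBpos hb0)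
  have hprod := cubic_mul_cubic_le hα0 hα1 hβ0 hβ1 (hc α hα0 hα1).1 (hc α hα0 hα1).2
    (hc β hβ0 hβ1).1 (hc β hβ0 hβ1).2 hδ0.le hδ1 hH he2 he2' he3 he3' he4 he4'
  rw [← he1, ← he1'] at hprod
  have hu' : u (s + δ • y) ^ α = a ^ α * (u (s + δ • y) / a) ^ α := by
    rw [← Real.mul_rpow ha0.le (by positivity), mul_div_cancel₀ _ ha0.ne']
  have hv' : v (t + δ • z) ^ β = b ^ β * (v (t + δ • z) / b) ^ β := by
    rw [← Real.mul_rpow hb0.le (by positivity), mul_div_cancel₀ _ hb0.ne']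
  rw [hu', hv', mul_mul_mul_comm]
  refine mul_le_mul_of_nonneg_left (le_trans ?_ hprod) (by positivity)
  exact mul_le_mul hA hB (by positivity) (le_trans (by positivity) hA)

theorem integrable_and_integral_quadratic_nonpos {α β ρ σ a b : ℝ} (hα0 : 0 ≤ α) (hα1 : α ≤ 1)
    (hβ0 : 0 ≤ β) (hβ1 : β ≤ 1) (hρ : 0 ≤ ρ) (hρσ : ρ ^ 2 + σ ^ 2 = 1)
    (h : ρ ^ 2 * (α * β) ≤ (1 - α) * (1 - β)) (ha : 0 < a) (hb : 0 < b) (v v' : E) :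
    Integrable (fun w : E × E => -(α * (1 - α) / 2) * (⟪v, ρ • w.1 + σ • w.2⟫ / a) ^ 2 +
      α * β * (⟪v, ρ • w.1 + σ • w.2⟫ / a * (⟪v', w.1⟫ / b)) -
      β * (1 - β) / 2 * (⟪v', w.1⟫ / b) ^ 2) γ₂ ∧
    ∫ w, (-(α * (1 - α) / 2) * (⟪v, ρ • w.1 + σ • w.2⟫ / a) ^ 2 +
      α * β * (⟪v, ρ • w.1 + σ • w.2⟫ / a * (⟪v', w.1⟫ / b)) -
      β * (1 - β) / 2 * (⟪v', w.1⟫ / b) ^ 2) ∂γ₂ ≤ 0 := by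
  have hX : MemLp (fun w : E × E => ⟪v, ρ • w.1 + σ • w.2⟫) 2 γ₂ :=
    (memLp_inner_stdGaussian v).comp_measurePreserving
      (measurePreserving_stdGaussian_rotation hρσ)
  have hY : MemLp (fun w : E × E => ⟪v', w.1⟫) 2 γ₂ := (memLp_inner_stdGaussian v').comp_fst γ
  have h1 : Integrable (fun w : E × E =>
      -(α * (1 - α) / 2) * (⟪v, ρ • w.1 + σ • w.2⟫ / a) ^ 2) γ₂ := by
    simp_rw [div_pow]
    exact (hX.integrable_sq.div_const _).const_mul _
  have h2 : Integrable (fun w : E × E =>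
      α * β * (⟪v, ρ • w.1 + σ • w.2⟫ / a * (⟪v', w.1⟫ / b))) γ₂ := by
    simp_rw [div_mul_div_comm]
    exact ((hX.integrable_mul hY).div_const _).const_mul _
  have h3 : Integrable (fun w : E × E => β * (1 - β) / 2 * (⟪v', w.1⟫ / b) ^ 2) γ₂ := by
    simp_rw [div_pow]
    exact (hY.integrable_sq.div_const _).const_mul _
  have h12 : Integrable (fun w : E × E => -(α * (1 - α) / 2) * (⟪v, ρ • w.1 + σ • w.2⟫ / a) ^ 2 +
      α * β * (⟪v, ρ • w.1 + σ • w.2⟫ / a * (⟪v', w.1⟫ / b))) γ₂ := h1.add h2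
  refine ⟨h12.sub h3, ?_⟩
  rw [integral_sub h12 h3, integral_add h1 h2]
  simp_rw [integral_const_mul, div_mul_div_comm, div_pow, integral_div]
  rw [integral_comp_rotation hρσ (f := fun x => ⟪v, x⟫ ^ 2) (by fun_prop),
    integral_fun_fst (fun x : E => ⟪v', x⟫ ^ 2), integral_inner_sq_stdGaussian,
    integral_inner_sq_stdGaussian, integral_inner_rotation_mul_inner]
  have := quadratic_form_nonpos (P := ‖v‖ / a) (Q := ‖v'‖ / b) (R := ⟪v, v'⟫ / (a * b))
    hα0 hα1 hβ0 hβ1 hρ h (by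
      rw [div_mul_div_comm]; gcongr; exact real_inner_le_norm v v')
  simp only [div_pow] at this
  simpa [mul_div_assoc] using this

theorem integral_rotation_div_sub_one {ρ σ : ℝ} (h : ρ ^ 2 + σ ^ 2 = 1) {f : E → ℝ}
    (hf : Continuous f) (hInt : Integrable f γ) (h0 : ∫ x, f x ∂γ ≠ 0) :
    Integrable (fun w : E × E => f (ρ • w.1 + σ • w.2) / (∫ x, f x ∂γ) - 1) γ₂ ∧
      ∫ w, (f (ρ • w.1 + σ • w.2) / (∫ x, f x ∂γ) - 1) ∂γ₂ = 0 := by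
  have h1 : Integrable (fun w : E × E => f (ρ • w.1 + σ • w.2) / (∫ x, f x ∂γ)) γ₂ :=
    ((measurePreserving_stdGaussian_rotation h).integrable_comp_of_integrable hInt).div_const _
  refine ⟨h1.sub (integrable_const _), ?_⟩
  rw [integral_sub h1 (integrable_const _), integral_div, integral_comp_rotation h hf, div_self h0]
  simp

theorem exists_integral_rpow_mul_rpow_le {m M K L α β ρ σ : ℝ} (hα0 : 0 ≤ α) (hα1 : α ≤ 1)
    (hβ0 : 0 ≤ β) (hβ1 : β ≤ 1) (hρ : 0 ≤ ρ) (hρσ : ρ ^ 2 + σ ^ 2 = 1)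
    (h : ρ ^ 2 * (α * β) ≤ (1 - α) * (1 - β)) (hm : 0 < m) :
    ∃ C : ℝ, ∀ (u v : E → ℝ) (g k : E → E) (δ : ℝ) (s t : E), HasTaylorBounds u g m M K L →
      HasTaylorBounds v k m M K L → 0 < δ → δ ≤ 1 →
      ∫ w, u (s + δ • (ρ • w.1 + σ • w.2)) ^ α * v (t + δ • w.1) ^ β ∂γ₂ ≤
        (∫ x, u (s + δ • x) ∂γ) ^ α * (∫ x, v (t + δ • x) ∂γ) ^ β + C * δ ^ 3 := by
  obtain ⟨D, hDdef⟩ : ∃ D, D = 1 + (K + L * (1 + ∫ x : E, ‖x‖ ^ 2 ∂γ)) / m := ⟨_, rfl⟩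
  obtain ⟨J, hJdef⟩ : ∃ J, J = ∫ w : E × E, (1 + ‖w.1‖ + ‖w.2‖) ^ 12 ∂γ₂ := ⟨_, rfl⟩
  refine ⟨M ^ α * M ^ β * (20 * D ^ 6 * J), fun u v g k δ s t hu hv hδ0 hδ1 => ?_⟩
  have hK : 0 ≤ K := (norm_nonneg _).trans (hu.norm_grad_le 0)
  have hL : 0 ≤ L := hu.nonneg
  have hm₂ : 0 ≤ ∫ x : E, ‖x‖ ^ 2 ∂γ := integral_nonneg fun x => by positivity
  have hD : 0 ≤ D := by rw [hDdef]; positivity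
  have hJ : 0 ≤ J := hJdef ▸ integral_nonneg fun w => by positivity
  have hM : 0 ≤ M := hm.le.trans ((hu.lower 0).trans (hu.upper 0))
  obtain ⟨a, ha⟩ : ∃ a, a = ∫ x, u (s + δ • x) ∂γ := ⟨_, rfl⟩
  obtain ⟨b, hb⟩ : ∃ b, b = ∫ x, v (t + δ • x) ∂γ := ⟨_, rfl⟩
  have ha0 : 0 < a := ha ▸ hm.trans_le (hu.le_average δ s)
  have hb0 : 0 < b := hb ▸ hm.trans_le (hv.le_average δ t)
  have haM : a ≤ M := ha ▸ hu.average_le δ s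
  have hbM : b ≤ M := hb ▸ hv.average_le δ t
  have hcu := hu.continuous
  have hcv := hv.continuous
  obtain ⟨hA, hA0⟩ := integral_rotation_div_sub_one hρσ (f := fun x => u (s + δ • x))
    (by fun_prop) (hu.integrable_comp (by fun_prop)) (ha ▸ ha0.ne')
  obtain ⟨hB, hB0⟩ := integral_rotation_div_sub_one (ρ := 1) (σ := 0) (by norm_num)
    (f := fun x => v (t + δ • x)) (by fun_prop) (hv.integrable_comp (by fun_prop)) (hb ▸ hb0.ne')
  simp only [← ha, ← hb, one_smul, zero_smul, add_zero] at hA hA0 hB hB0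
  obtain ⟨hQ, hQ0⟩ := integrable_and_integral_quadratic_nonpos hα0 hα1 hβ0 hβ1 hρ hρσ h ha0 hb0
    (g s) (k t)
  have hE := integrable_one_add_norm_add_norm_pow (E := E) 12
  have habs : ∀ r r' : ℝ, r ^ 2 + r' ^ 2 = 1 → |r| ≤ 1 := fun r r' hr =>
    abs_le_one_iff_mul_self_le_one.2 (by nlinarith [sq_nonneg r'])
  have hρ1 := habs ρ σ hρσ
  have hσ1 := habs σ ρ (by linarith)
  rw [← ha, ← hb]
  have hpt : ∀ w : E × E, u (s + δ • (ρ • w.1 + σ • w.2)) ^ α * v (t + δ • w.1) ^ β ≤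
      a ^ α * b ^ β * (1 + α * (u (s + δ • (ρ • w.1 + σ • w.2)) / a - 1) +
        β * (v (t + δ • w.1) / b - 1) +
        δ ^ 2 * (-(α * (1 - α) / 2) * (⟪g s, ρ • w.1 + σ • w.2⟫ / a) ^ 2 +
          α * β * (⟪g s, ρ • w.1 + σ • w.2⟫ / a * (⟪k t, w.1⟫ / b)) -
          β * (1 - β) / 2 * (⟪k t, w.1⟫ / b) ^ 2) +
        20 * δ ^ 3 * D ^ 6 * (1 + ‖w.1‖ + ‖w.2‖) ^ 12) := fun w => by
    have hn1 := norm_nonneg w.1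
    have hn2 := norm_nonneg w.2
    have hy : ‖ρ • w.1 + σ • w.2‖ ≤ 1 + ‖w.1‖ + ‖w.2‖ := by
      refine (norm_add_le _ _).trans ?_
      rw [norm_smul, norm_smul, Real.norm_eq_abs, Real.norm_eq_abs]
      nlinarith
    refine (hu.rpow_mul_rpow_le hv hα0 hα1 hβ0 hβ1 hm hδ0 hδ1 s t _ w.1 (by linarith) hy
      (by linarith) ha hb).trans (le_of_eq ?_)
    rw [← hDdef, mul_pow, ← pow_mul]
    ring
  have hE' := hE.const_mul (20 * δ ^ 3 * D ^ 6)
  have i1 : Integrable (fun w : E × E => 1 + α * (u (s + δ • (ρ • w.1 + σ • w.2)) / a - 1)) γ₂ :=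
    (integrable_const _).add (hA.const_mul α)
  have i2 := i1.add (hB.const_mul β)
  have i3 := i2.add (hQ.const_mul (δ ^ 2))
  have i4 := (i3.add hE').const_mul (a ^ α * b ^ β)
  have hnn : ∀ w : E × E, 0 ≤ u (s + δ • (ρ • w.1 + σ • w.2)) ^ α * v (t + δ • w.1) ^ β := fun w =>
    mul_nonneg (Real.rpow_nonneg (hm.le.trans (hu.lower _)) _)
      (Real.rpow_nonneg (hm.le.trans (hv.lower _)) _)
  refine (integral_mono_of_nonneg (ae_of_all _ hnn) i4 (ae_of_all _ hpt)).trans ?_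
  rw [integral_const_mul, integral_add' i3 hE', integral_add' i2 (hQ.const_mul (δ ^ 2)),
    integral_add' i1 (hB.const_mul β), integral_add (integrable_const _) (hA.const_mul α)]
  rw [integral_const_mul, hA0, integral_const_mul, hB0, integral_const_mul, integral_const_mul]
  have hab : a ^ α * b ^ β ≤ M ^ α * M ^ β := by gcongr
  have hab0 : 0 ≤ a ^ α * b ^ β := by positivity
  have hδQ := mul_nonpos_of_nonneg_of_nonpos (mul_nonneg hab0 (sq_nonneg δ)) hQ0
  have hrest := mul_le_mul_of_nonneg_right hab (by positivity : 0 ≤ 20 * δ ^ 3 * D ^ 6 * J)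
  simp only [integral_const, probReal_univ, smul_eq_mul, mul_one, mul_zero, add_zero]
  rw [← hJdef]
  generalize (integral γ₂ _ : ℝ) = Q at hδQ ⊢
  linarith

theorem integral_integral_smul_add_smul {F : Type*} [NormedAddCommGroup F] [NormedSpace ℝ F]
    [CompleteSpace F] [SecondCountableTopology F] [MeasurableSpace F] [BorelSpace F]
    (ν : Measure F) [IsGaussian ν] (hν : ∀ L : StrongDual ℝ F, ∫ x, L x ∂ν = 0) (a b : ℝ)
    {φ : F → ℝ} (hφ : Continuous φ) {C : ℝ} (hC : ∀ x, |φ x| ≤ C) :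
    ∫ x, ∫ y, φ (a • x + b • y) ∂ν ∂ν = ∫ x, φ (√(a ^ 2 + b ^ 2) • x) ∂ν := by
  have hInt : Integrable (fun w : F × F => φ (a • w.1 + b • w.2)) (ν.prod ν) :=
    .of_bound (by fun_prop) C (ae_of_all _ fun w => hC _)
  rw [← integral_prod _ hInt]
  have h1 := integral_map (μ := ν.prod ν) (φ := fun w : F × F => a • w.1 + b • w.2) (by fun_prop)
    (f := φ) hφ.aestronglyMeasurable
  have h2 := integral_map (μ := ν) (φ := fun x => √(a ^ 2 + b ^ 2) • x) (by fun_prop)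
    (f := φ) hφ.aestronglyMeasurable
  rw [← h1, ← h2, map_smul_add_smul_of_isGaussian ν hν]

theorem integral_strongDual_prod_stdGaussian (L : StrongDual ℝ (E × E)) :
    ∫ w, L w ∂γ₂ = 0 := by
  have h1 : ∀ w : E × E, L w = L.comp (.inl ℝ E E) w.1 + L.comp (.inr ℝ E E) w.2 := fun w => by
    simp [← map_add]
  simp_rw [h1]
  rw [integral_add ((IsGaussian.integrable_dual γ _).comp_fst γ)
    ((IsGaussian.integrable_dual γ _).comp_snd γ), integral_fun_fst, integral_fun_snd,
    ProbabilityTheory.integral_strongDual_stdGaussian,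
    ProbabilityTheory.integral_strongDual_stdGaussian]
  simp

namespace HasTaylorBounds

variable {u v : E → ℝ} {g k : E → E} {m M K L α β : ℝ}

theorem abs_rpow_mul_rpow_le (hu : HasTaylorBounds u g m M K L) (hv : HasTaylorBounds v k m M K L)
    (hm : 0 < m) (hα : 0 ≤ α) (hβ : 0 ≤ β) (x y : E) :
    |u x ^ α * v y ^ β| ≤ M ^ α * M ^ β := by
  have hx : 0 ≤ u x := hm.le.trans (hu.lower x)
  have hy : 0 ≤ v y := hm.le.trans (hv.lower y)
  have := hu.upper x
  have := hv.upper y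
  rw [abs_of_nonneg (by positivity)]
  have : 0 ≤ M := hx.trans (hu.upper x)
  gcongr

theorem continuous_rpow_mul_rpow (hu : HasTaylorBounds u g m M K L)
    (hv : HasTaylorBounds v k m M K L) (hα : 0 ≤ α) (hβ : 0 ≤ β) :
    Continuous fun w : E × E => u w.1 ^ α * v w.2 ^ β :=
  ((hu.continuous.comp continuous_fst).rpow_const fun _ => .inr hα).mul
    ((hv.continuous.comp continuous_snd).rpow_const fun _ => .inr hβ)

theorem integral_average (hu : HasTaylorBounds u g m M K L) (a δ : ℝ) (s : E) :
    ∫ x, ∫ y, u ((s + a • x) + δ • y) ∂γ ∂γ = ∫ x, u (s + √(a ^ 2 + δ ^ 2) • x) ∂γ := by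
  have := hu.continuous
  simp_rw [add_assoc]
  exact integral_integral_smul_add_smul γ ProbabilityTheory.integral_strongDual_stdGaussian a δ
    (φ := fun x => u (s + x)) (by fun_prop) (C := max |m| |M|)
    fun x => abs_le_max_abs_abs (hu.lower _) (hu.upper _)

end HasTaylorBounds

theorem integral_rpow_mul_rpow_le_of_step {m M K L α β ρ σ δ c : ℝ} (hα : 0 ≤ α)
    (hβ : 0 ≤ β) (hm : 0 < m)
    (hstep : ∀ (u v : E → ℝ) (g k : E → E) (s t : E), HasTaylorBounds u g m M K L →
      HasTaylorBounds v k m M K L →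
      ∫ w, u (s + δ • (ρ • w.1 + σ • w.2)) ^ α * v (t + δ • w.1) ^ β ∂γ₂ ≤
        (∫ x, u (s + δ • x) ∂γ) ^ α * (∫ x, v (t + δ • x) ∂γ) ^ β + c)
    (hδ : 0 ≤ δ) (N : ℕ) :
    ∀ (u v : E → ℝ) (g k : E → E) (s t : E), HasTaylorBounds u g m M K L →
      HasTaylorBounds v k m M K L →
      ∫ w, u (s + (√N * δ) • (ρ • w.1 + σ • w.2)) ^ α * v (t + (√N * δ) • w.1) ^ β ∂γ₂ ≤
        (∫ x, u (s + (√N * δ) • x) ∂γ) ^ α * (∫ x, v (t + (√N * δ) • x) ∂γ) ^ β + N * c := by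
  induction N with
  | zero => intro u v g k s t hu hv; simp
  | succ N ih =>
    intro u v g k s t hu hv
    have hroot : √((N + 1 : ℕ) : ℝ) * δ = √((√N * δ) ^ 2 + δ ^ 2) := by
      rw [mul_pow, Real.sq_sqrt (Nat.cast_nonneg N), ← add_one_mul, Real.sqrt_mul (by positivity),
        Real.sqrt_sq hδ]
      simp
    rw [hroot, ← hu.integral_average, ← hv.integral_average]
    set a := √(N : ℝ) * δ with ha
    have hu' := hu.average γ (c := 1) (by simp) δ
    simp only [one_smul] at hu'
    have hv' := hv.average γ (c := 1) (by simp) δ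
    simp only [one_smul] at hv'
    have hc := hu.continuous_rpow_mul_rpow hv hα hβ
    have hc' := hu'.continuous_rpow_mul_rpow hv' hα hβ
    have hInt' : Integrable (fun w : E × E =>
        (∫ y, u ((s + a • (ρ • w.1 + σ • w.2)) + δ • y) ∂γ) ^ α *
          (∫ y, v ((t + a • w.1) + δ • y) ∂γ) ^ β) γ₂ :=
      .of_bound (hc'.comp (f := fun w : E × E => (s + a • (ρ • w.1 + σ • w.2), t + a • w.1))
        (by fun_prop)).aestronglyMeasurable _
        (ae_of_all _ fun w => hu'.abs_rpow_mul_rpow_le hv' hm hα hβ _ _)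
    let φ : E × E → ℝ := fun w => u (s + (ρ • w.1 + σ • w.2)) ^ α * v (t + w.1) ^ β
    have hφ : Continuous φ :=
      hc.comp (f := fun w : E × E => (s + (ρ • w.1 + σ • w.2), t + w.1)) (by fun_prop)
    have hφC : ∀ w, |φ w| ≤ M ^ α * M ^ β := fun w => hu.abs_rpow_mul_rpow_le hv hm hα hβ _ _
    have hsemi := integral_integral_smul_add_smul γ₂ integral_strongDual_prod_stdGaussian a δ
      hφ hφC
    have hlin : ∀ (r : ℝ) (w : E × E), φ (r • w) =
        u (s + r • (ρ • w.1 + σ • w.2)) ^ α * v (t + r • w.1) ^ β := fun r w => by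
      simp only [φ, Prod.smul_fst, Prod.smul_snd, smul_add, smul_comm r]
    have hlin₂ : ∀ w w' : E × E, φ (a • w + δ • w') =
        u ((s + a • (ρ • w.1 + σ • w.2)) + δ • (ρ • w'.1 + σ • w'.2)) ^ α *
          v ((t + a • w.1) + δ • w'.1) ^ β := fun w w' => by
      have h1 : ρ • (a • w.1 + δ • w'.1) + σ • (a • w.2 + δ • w'.2) =
          a • (ρ • w.1 + σ • w.2) + δ • (ρ • w'.1 + σ • w'.2) := by module
      simp only [φ, Prod.smul_fst, Prod.smul_snd, Prod.fst_add, Prod.snd_add, h1, add_assoc]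
    simp_rw [hlin, hlin₂] at hsemi
    rw [← hsemi]
    calc _ ≤ ∫ w : E × E, ((∫ y, u ((s + a • (ρ • w.1 + σ • w.2)) + δ • y) ∂γ) ^ α *
          (∫ y, v ((t + a • w.1) + δ • y) ∂γ) ^ β + c) ∂γ₂ := by
          refine integral_mono_of_nonneg (ae_of_all _ fun w => integral_nonneg fun w' => ?_)
            (hInt'.add (integrable_const c)) (ae_of_all _ fun w => hstep u v g k _ _ hu hv)
          exact mul_nonneg (Real.rpow_nonneg (hm.le.trans (hu.lower _)) _)
            (Real.rpow_nonneg (hm.le.trans (hv.lower _)) _)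
      _ = (∫ w : E × E, (∫ y, u ((s + a • (ρ • w.1 + σ • w.2)) + δ • y) ∂γ) ^ α *
          (∫ y, v ((t + a • w.1) + δ • y) ∂γ) ^ β ∂γ₂) + c := by
          rw [integral_add hInt' (integrable_const c)]; simp
      _ ≤ _ := by
          have := ih _ _ _ _ s t hu' hv'
          push_cast
          linarith

/-- Gaussian Hölder-type inequality for a pair of `ρ`-correlated standard Gaussian vectors. -/
theorem HasTaylorBounds.integral_rotation_rpow_mul_rpow_le {u v : E → ℝ} {g k : E → E}
    {m M K L α β ρ σ : ℝ} (hu : HasTaylorBounds u g m M K L) (hv : HasTaylorBounds v k m M K L)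
    (hα0 : 0 ≤ α) (hα1 : α ≤ 1)
    (hβ0 : 0 ≤ β) (hβ1 : β ≤ 1) (hρ : 0 ≤ ρ) (hρσ : ρ ^ 2 + σ ^ 2 = 1)
    (h : ρ ^ 2 * (α * β) ≤ (1 - α) * (1 - β)) (hm : 0 < m) :
    ∫ w, u (ρ • w.1 + σ • w.2) ^ α * v w.1 ^ β ∂γ₂ ≤
      (∫ x, u x ∂γ) ^ α * (∫ x, v x ∂γ) ^ β := by
  obtain ⟨C, hC⟩ := exists_integral_rpow_mul_rpow_le (E := E) (M := M) (K := K) (L := L)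
    hα0 hα1 hβ0 hβ1 hρ hρσ h hm
  have hN : ∀ N : ℕ, ∫ w, u (ρ • w.1 + σ • w.2) ^ α * v w.1 ^ β ∂γ₂ ≤
      (∫ x, u x ∂γ) ^ α * (∫ x, v x ∂γ) ^ β + C * √(1 / ((N : ℝ) + 1)) := fun N => by
    set δ := √(1 / ((N : ℝ) + 1)) with hδ
    have hδ0 : 0 < δ := by positivity
    have hδ1 : δ ≤ 1 := Real.sqrt_le_one.2 (by
      rw [div_le_one (by positivity)]; linarith [(Nat.cast_nonneg N : (0 : ℝ) ≤ N)])
    have hδ2 : ((N : ℝ) + 1) * δ ^ 2 = 1 := by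
      rw [hδ, Real.sq_sqrt (by positivity)]; field_simp
    have hone : √((N + 1 : ℕ) : ℝ) * δ = 1 := by
      rw [hδ, ← Real.sqrt_mul (by positivity)]
      push_cast
      rw [mul_one_div_cancel (by positivity), Real.sqrt_one]
    have := integral_rpow_mul_rpow_le_of_step (ρ := ρ) (σ := σ) hα0 hβ0 hm
      (fun u v g k s t hu hv => hC u v g k δ s t hu hv hδ0 hδ1) hδ0.le (N + 1) u v g k 0 0 hu hv
    rw [hone] at this
    simp only [one_smul, zero_add] at this
    refine this.trans (le_of_eq ?_)
    push_cast
    linear_combination C * δ * hδ2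
  have hlim : Filter.Tendsto (fun N : ℕ => (∫ x, u x ∂γ) ^ α * (∫ x, v x ∂γ) ^ β +
      C * √(1 / ((N : ℝ) + 1))) Filter.atTop
      (nhds ((∫ x, u x ∂γ) ^ α * (∫ x, v x ∂γ) ^ β + C * √0)) :=
    ((tendsto_one_div_add_atTop_nhds_zero_nat.sqrt).const_mul C).const_add _
  simpa using ge_of_tendsto' hlim hN

theorem HasTaylorBounds.mono {u : E → ℝ} {g : E → E} {m M K L m' M' K' L' : ℝ}
    (h : HasTaylorBounds u g m M K L) (hm : m' ≤ m) (hM : M ≤ M') (hK : K ≤ K') (hL : L ≤ L') :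
    HasTaylorBounds u g m' M' K' L' where
  lower x := hm.trans (h.lower x)
  upper x := (h.upper x).trans hM
  measurable_grad := h.measurable_grad
  norm_grad_le x := (h.norm_grad_le x).trans hK
  lipschitz x y := (h.lipschitz x y).trans (by gcongr)
  nonneg := h.nonneg.trans hL
  taylor x y := (h.taylor x y).trans (by gcongr)

theorem HasTaylorBounds.exists_rpow {u : E → ℝ} {g : E → E} {m M K L r : ℝ}
    (h : HasTaylorBounds u g m M K L) (hm : 0 < m) (hr : 0 ≤ r) :
    ∃ g' K' L', HasTaylorBounds (fun x => u x ^ r) g' (m ^ r) (M ^ r) K' L' :=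
  h.comp_contDiff (fun _ ht => Real.contDiffAt_rpow_const (.inl (hm.trans_le ht.1).ne'))
    (fun _ ht => Real.rpow_le_rpow hm.le ht.1 hr)
    (fun _ ht => Real.rpow_le_rpow (hm.le.trans ht.1) ht.2 hr)

theorem HasTaylorBounds.mehler_hypercontractive {f : E → ℝ} {g : E → E} {m M K L ρ σ p q : ℝ}
    (hf : HasTaylorBounds f g m M K L) (hm : 0 < m) (hρ : 0 ≤ ρ) (hρσ : ρ ^ 2 + σ ^ 2 = 1)
    (hp : 1 < p) (hq : 1 < q) (hpq : ρ ^ 2 * (q - 1) ≤ p - 1) :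
    (∫ x, (∫ y, f (ρ • x + σ • y) ∂γ) ^ q ∂γ) ^ (1 / q) ≤ (∫ x, f x ^ p ∂γ) ^ (1 / p) := by
  have hp0 : 0 < p := by linarith
  have hq0 : 0 < q := by linarith
  have hρ1 : |ρ| ≤ 1 := abs_le_one_iff_mul_self_le_one.2 (by nlinarith [sq_nonneg σ])
  have hP := hf.average γ hρ1 σ
  obtain ⟨gu, Ku, Lu, hu⟩ := hf.exists_rpow hm hp0.le
  obtain ⟨gv, Kv, Lv, hv⟩ := hP.exists_rpow hm hq0.le
  have hmp : 0 < min (m ^ p) (m ^ q) := by positivity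
  have hα1 : 1 / p ≤ 1 := (div_le_one hp0).2 hp.le
  have hβ1 : 1 / q ≤ 1 := (div_le_one hq0).2 hq.le
  have hpow : 0 < 1 / p ∧ 0 < 1 / q := ⟨by positivity, by positivity⟩
  have hcond : ρ ^ 2 * (1 / p * (1 - 1 / q)) ≤ (1 - 1 / p) * (1 - (1 - 1 / q)) := by
    have h1 : ρ ^ 2 * (1 / p * (1 - 1 / q)) = ρ ^ 2 * (q - 1) / (p * q) := by field_simp
    have h2 : (1 - 1 / p) * (1 - (1 - 1 / q)) = (p - 1) / (p * q) := by field_simp; ring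
    rw [h1, h2]
    gcongr
  have key := (hu.mono (min_le_left _ _) (le_max_left _ _) (le_max_left _ _)
    (le_max_left _ _)).integral_rotation_rpow_mul_rpow_le (hv.mono (min_le_right _ _)
    (le_max_right _ _) (le_max_right _ _) (le_max_right _ _)) hpow.1.le hα1
    (β := 1 - 1 / q) (by linarith) (by linarith) hρ hρσ hcond hmp
  have hf0 : ∀ x, 0 < f x := fun x => hm.trans_le (hf.lower x)
  have hP0 : ∀ x, 0 < ∫ y, f (ρ • x + σ • y) ∂γ := fun x => hm.trans_le (hP.lower x)
  have hfp : ∀ x, (f x ^ p) ^ (1 / p) = f x := fun x => by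
    rw [← Real.rpow_mul (hf0 x).le, mul_one_div_cancel hp0.ne', Real.rpow_one]
  have hPq : ∀ x, ((∫ y, f (ρ • x + σ • y) ∂γ) ^ q) ^ (1 - 1 / q) =
      (∫ y, f (ρ • x + σ • y) ∂γ) ^ (q - 1) := fun x => by
    rw [← Real.rpow_mul (hP0 x).le, mul_sub, mul_one_div_cancel hq0.ne', mul_one]
  have hInt : Integrable (fun w : E × E => f (ρ • w.1 + σ • w.2) *
      (∫ y, f (ρ • w.1 + σ • y) ∂γ) ^ (q - 1)) γ₂ := by
    have hc := hf.continuous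
    have hc' := hP.continuous
    refine .of_bound (C := M * M ^ (q - 1)) ?_ (ae_of_all _ fun w => ?_)
    · refine (Continuous.mul (by fun_prop) ?_).aestronglyMeasurable
      exact (hc'.comp continuous_fst).rpow_const fun _ => .inr (by linarith)
    · have h1 := hP0 w.1
      have h2 := hP.upper w.1
      have h3 := hf0 (ρ • w.1 + σ • w.2)
      have h4 := hf.upper (ρ • w.1 + σ • w.2)
      have h5 : 0 ≤ q - 1 := by linarith
      have h6 := Real.rpow_le_rpow h1.le h2 h5
      have h7 := Real.rpow_nonneg h1.le (q - 1)
      rw [Real.norm_eq_abs, abs_of_nonneg (mul_nonneg h3.le h7)]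
      exact mul_le_mul h4 h6 h7 (h3.le.trans h4)
  simp_rw [hfp, hPq] at key
  rw [integral_prod _ hInt] at key
  simp_rw [integral_mul_const] at key
  have hmul : ∀ x, (∫ y, f (ρ • x + σ • y) ∂γ) * (∫ y, f (ρ • x + σ • y) ∂γ) ^ (q - 1) =
      (∫ y, f (ρ • x + σ • y) ∂γ) ^ q := fun x => by
    rw [← Real.rpow_one_add' (hP0 x).le (by linarith)]; congr 1; ring
  simp_rw [hmul] at key
  have hI : 0 < ∫ x, (∫ y, f (ρ • x + σ • y) ∂γ) ^ q ∂γ :=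
    (Real.rpow_pos_of_pos hm q).trans_le (by simpa using hv.le_average 1 (0 : E))
  generalize (∫ x, (∫ y, f (ρ • x + σ • y) ∂γ) ^ q ∂γ) = I at key hI ⊢
  refine le_of_mul_le_mul_right ?_ (Real.rpow_pos_of_pos hI (1 - 1 / q))
  rw [← Real.rpow_add hI]
  simpa using key

theorem HasTaylorBounds.lintegral_mehler_le {f : E → ℝ} {g : E → E} {m M K L ρ σ p q : ℝ}
    (hf : HasTaylorBounds f g m M K L) (hm : 0 < m) (hρ : 0 ≤ ρ) (hρσ : ρ ^ 2 + σ ^ 2 = 1)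
    (hp : 1 < p) (hq : 1 < q) (hpq : ρ ^ 2 * (q - 1) ≤ p - 1) :
    (∫⁻ x, (∫⁻ y, ENNReal.ofReal (f (ρ • x + σ • y)) ∂γ) ^ q ∂γ) ^ (1 / q) ≤
      (∫⁻ x, ENNReal.ofReal (f x) ^ p ∂γ) ^ (1 / p) := by
  have hp0 : 0 < p := by linarith
  have hq0 : 0 < q := by linarith
  have hρ1 : |ρ| ≤ 1 := abs_le_one_iff_mul_self_le_one.2 (by nlinarith [sq_nonneg σ])
  have hP := hf.average γ hρ1 σ
  obtain ⟨gu, Ku, Lu, hu⟩ := hf.exists_rpow hm hp0.le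
  obtain ⟨gv, Kv, Lv, hv⟩ := hP.exists_rpow hm hq0.le
  have hf0 : ∀ x, 0 < f x := fun x => hm.trans_le (hf.lower x)
  have hP0 : ∀ x, 0 < ∫ y, f (ρ • x + σ • y) ∂γ := fun x => hm.trans_le (hP.lower x)
  have h1 : ∀ x, ∫⁻ y, ENNReal.ofReal (f (ρ • x + σ • y)) ∂γ =
      ENNReal.ofReal (∫ y, f (ρ • x + σ • y) ∂γ) := fun x =>
    (ofReal_integral_eq_lintegral_ofReal (hf.integrable_comp (by fun_prop))
      (ae_of_all _ fun y => (hf0 _).le)).symm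
  simp_rw [h1, fun x => ENNReal.ofReal_rpow_of_pos (p := q) (hP0 x),
    fun x => ENNReal.ofReal_rpow_of_pos (p := p) (hf0 x)]
  have hu' : Integrable (fun x => f x ^ p) γ := hu.integrable_comp measurable_id
  have hv' : Integrable (fun x => (∫ y, f (ρ • x + σ • y) ∂γ) ^ q) γ :=
    hv.integrable_comp measurable_id
  rw [← ofReal_integral_eq_lintegral_ofReal hv'
      (ae_of_all _ fun x => Real.rpow_nonneg (hP0 x).le _),
    ← ofReal_integral_eq_lintegral_ofReal hu'
      (ae_of_all _ fun x => Real.rpow_nonneg (hf0 x).le _),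
    ENNReal.ofReal_rpow_of_nonneg (integral_nonneg fun x => Real.rpow_nonneg (hP0 x).le _)
      (by positivity),
    ENNReal.ofReal_rpow_of_nonneg (integral_nonneg fun x => Real.rpow_nonneg (hf0 x).le _)
      (by positivity)]
  exact ENNReal.ofReal_le_ofReal (hf.mehler_hypercontractive hm hρ hρσ hp hq hpq)

theorem HasTaylorBounds.exists_sqrt_sq_add_sq {h : E → ℝ} {g : E → E} {m M K L ε : ℝ}
    (hh : HasTaylorBounds h g m M K L) (hε : 0 < ε) :
    ∃ g' M' K' L', HasTaylorBounds (fun x => √(h x ^ 2 + ε ^ 2)) g' ε M' K' L' := by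
  obtain ⟨g', K', L', h'⟩ := hh.comp_contDiff (θ := fun t => √(t ^ 2 + ε ^ 2)) (m' := ε)
    (M' := √(max |m| |M| ^ 2 + ε ^ 2))
    (fun t _ => ((contDiffAt_id.pow 2).add contDiffAt_const).sqrt (by simp only [id]; positivity))
    (fun t _ => Real.le_sqrt_of_sq_le (by linarith [sq_nonneg t]))
    (fun t ht => Real.sqrt_le_sqrt (by
      have := sq_le_sq.2 ((abs_le_max_abs_abs ht.1 ht.2).trans (le_abs_self _))
      linarith))
  exact ⟨g', _, K', L', h'⟩

theorem exists_hasTaylorBounds_approx {μ : Measure E} [IsProbabilityMeasure μ] {p : ENNReal}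
    (hp1 : 1 ≤ p) (hp : p ≠ ⊤) {F : E → ℝ} (hF : MemLp F p μ) (hF0 : ∀ x, 0 ≤ F x) :
    ∃ φ : ℕ → E → ℝ,
      (∀ k, ∃ g m M K L, 0 < m ∧ HasTaylorBounds (φ k) g m M K L) ∧
      (∀ᵐ x ∂μ, Filter.Tendsto (fun k => φ k x) Filter.atTop (nhds (F x))) ∧
      ∀ k, eLpNorm (φ k) p μ ≤ eLpNorm F p μ + ENNReal.ofReal (2 * (1 / ((k : ℝ) + 1))) := by
  have hε : ∀ k : ℕ, 0 < 1 / ((k : ℝ) + 1) := fun k => Nat.one_div_pos_of_nat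
  choose h hc hd hle using fun k : ℕ => hF.exist_eLpNorm_sub_le hp hp1 (hε k)
  have hsm : ∀ k, AEStronglyMeasurable (h k) μ := fun k => (hd k).continuous.aestronglyMeasurable
  have hle' : ∀ k, eLpNorm (h k - F) p μ ≤ ENNReal.ofReal (1 / ((k : ℝ) + 1)) := fun k => by
    rw [eLpNorm_sub_comm]; exact hle k
  have hlim : Filter.Tendsto (fun k => eLpNorm (h k - F) p μ) Filter.atTop (nhds 0) := by
    refine tendsto_of_tendsto_of_tendsto_of_le_of_le tendsto_const_nhds ?_ (fun _ => zero_le) hle'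
    simpa using ENNReal.tendsto_ofReal tendsto_one_div_add_atTop_nhds_zero_nat
  obtain ⟨ns, hns, hae⟩ := (tendstoInMeasure_of_tendsto_eLpNorm (by positivity) hsm
    hF.aestronglyMeasurable hlim).exists_seq_tendsto_ae
  refine ⟨fun k x => √(h (ns k) x ^ 2 + (1 / ((k : ℝ) + 1)) ^ 2), fun k => ?_, ?_, fun k => ?_⟩
  · obtain ⟨g, m, M, K, L, hT⟩ := exists_hasTaylorBounds_of_hasCompactSupport (hc (ns k))
      (contDiff_infty.1 (hd (ns k)) 2)
    obtain ⟨g', M', K', L', hT'⟩ := hT.exists_sqrt_sq_add_sq (hε k)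
    exact ⟨g', _, M', K', L', hε k, hT'⟩
  · filter_upwards [hae] with x hx
    have := ((hx.pow 2).add
      ((tendsto_one_div_add_atTop_nhds_zero_nat (𝕜 := ℝ)).pow 2)).sqrt
    simpa [Real.sqrt_sq (hF0 x)] using this
  · have hk : 1 / ((ns k : ℝ) + 1) ≤ 1 / ((k : ℝ) + 1) :=
      one_div_le_one_div_of_le (by positivity) (by gcongr; exact hns.id_le k)
    have hpt : ∀ x, ‖√(h (ns k) x ^ 2 + (1 / ((k : ℝ) + 1)) ^ 2)‖ ≤
        ‖F x‖ + ‖(h (ns k) - F) x‖ + 1 / ((k : ℝ) + 1) := fun x => by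
      have h1 : |h (ns k) x| ≤ |F x| + |h (ns k) x - F x| := by
        simpa using abs_add_le (F x) (h (ns k) x - F x)
      have h2 : √(h (ns k) x ^ 2 + (1 / ((k : ℝ) + 1)) ^ 2) ≤ |h (ns k) x| + 1 / ((k : ℝ) + 1) := by
        rw [Real.sqrt_le_left (by have := hε k; positivity)]
        nlinarith [sq_abs (h (ns k) x), abs_nonneg (h (ns k) x), (hε k).le,
          mul_nonneg (abs_nonneg (h (ns k) x)) (hε k).le]
      rw [Real.norm_of_nonneg (Real.sqrt_nonneg _), Real.norm_eq_abs, Real.norm_eq_abs,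
        Pi.sub_apply]
      linarith
    calc _ ≤ eLpNorm (fun x => ‖F x‖ + ‖(h (ns k) - F) x‖ + 1 / ((k : ℝ) + 1)) p μ :=
          eLpNorm_mono_real hpt
      _ ≤ eLpNorm F p μ + eLpNorm (h (ns k) - F) p μ +
          ENNReal.ofReal (1 / ((k : ℝ) + 1)) := by
          have e1 : AEStronglyMeasurable (fun x => ‖F x‖) μ := hF.aestronglyMeasurable.norm
          have e2 : AEStronglyMeasurable (fun x => ‖(h (ns k) - F) x‖) μ :=
            ((hsm (ns k)).sub hF.aestronglyMeasurable).norm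
          refine (eLpNorm_add_le (e1.add e2) aestronglyMeasurable_const hp1).trans ?_
          gcongr
          · refine (eLpNorm_add_le e1 e2 hp1).trans ?_
            rw [eLpNorm_norm, eLpNorm_norm]
          · rw [eLpNorm_const _ (by positivity) (IsProbabilityMeasure.ne_zero μ),
              Real.enorm_eq_ofReal_abs, abs_of_pos (hε k)]
            simp
      _ ≤ eLpNorm F p μ + ENNReal.ofReal (1 / ((k : ℝ) + 1)) +
          ENNReal.ofReal (1 / ((k : ℝ) + 1)) := by
          gcongr
          exact (hle' _).trans (ENNReal.ofReal_le_ofReal hk)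
      _ = _ := by
          rw [add_assoc, ← ENNReal.ofReal_add (hε k).le (hε k).le, two_mul]

theorem lintegral_le_lintegral_rpow {Ω : Type*} [MeasurableSpace Ω] {μ : Measure Ω}
    [IsProbabilityMeasure μ] {p : ℝ} (hp : 1 ≤ p) {f : Ω → ENNReal} (hf : Measurable f) :
    ∫⁻ x, f x ∂μ ≤ (∫⁻ x, f x ^ p ∂μ) ^ (1 / p) := by
  have := eLpNorm'_le_eLpNorm'_of_exponent_le one_pos hp μ hf.aestronglyMeasurable
  simpa [eLpNorm'] using this

theorem lintegral_mehler {ρ σ : ℝ} (hρσ : ρ ^ 2 + σ ^ 2 = 1) {f : E → ENNReal}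
    (hf : Measurable f) : ∫⁻ x, ∫⁻ y, f (ρ • x + σ • y) ∂γ ∂γ = ∫⁻ x, f x ∂γ := by
  have hmp := measurePreserving_stdGaussian_rotation (E := E) hρσ
  rw [← hmp.lintegral_comp hf]
  exact (lintegral_prod _ (hf.comp hmp.measurable).aemeasurable).symm

theorem measurable_mehler (ρ σ : ℝ) {f : E → ENNReal} (hf : Measurable f) :
    Measurable fun x => ∫⁻ y, f (ρ • x + σ • y) ∂γ :=
  Measurable.lintegral_prod_right' (f := fun w : E × E => f (ρ • w.1 + σ • w.2))
    (hf.comp (by fun_prop))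

theorem lintegral_mehler_rpow_le_of_one_lt {ρ σ p q : ℝ} (hρ : 0 ≤ ρ) (hρσ : ρ ^ 2 + σ ^ 2 = 1)
    (hp : 1 < p) (hq : 1 < q) (hpq : ρ ^ 2 * (q - 1) ≤ p - 1)
    {f : E → ENNReal} (hf : Measurable f) :
    (∫⁻ x, (∫⁻ y, f (ρ • x + σ • y) ∂γ) ^ q ∂γ) ^ (1 / q) ≤
      (∫⁻ x, f x ^ p ∂γ) ^ (1 / p) := by
  have hp0 : 0 < p := by linarith
  have hq0 : 0 < q := by linarith
  by_cases htop : ∫⁻ x, f x ^ p ∂γ = ⊤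
  · rw [htop, ENNReal.top_rpow_of_pos (by positivity)]
    exact le_top
  have hfin : ∀ᵐ x ∂γ, f x ≠ ⊤ := by
    filter_upwards [ae_lt_top (hf.pow_const p) htop] with x hx h
    rw [h, ENNReal.top_rpow_of_pos hp0] at hx
    exact hx.ne rfl
  have hnorm : ∀ u : E → ℝ, eLpNorm u (ENNReal.ofReal p) γ = (∫⁻ x, ‖u x‖ₑ ^ p ∂γ) ^ (1 / p) :=
    fun u => by
      rw [eLpNorm_eq_lintegral_rpow_enorm_toReal (by simpa using hp0) ENNReal.ofReal_ne_top,
        ENNReal.toReal_ofReal hp0.le]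
  have hF : eLpNorm (fun x => (f x).toReal) (ENNReal.ofReal p) γ =
      (∫⁻ x, f x ^ p ∂γ) ^ (1 / p) := by
    rw [hnorm]
    congr 1
    refine lintegral_congr_ae ?_
    filter_upwards [hfin] with x hx
    rw [Real.enorm_eq_ofReal ENNReal.toReal_nonneg, ENNReal.ofReal_toReal hx]
  have hmem : MemLp (fun x => (f x).toReal) (ENNReal.ofReal p) γ :=
    ⟨hf.ennreal_toReal.aestronglyMeasurable, by
      rw [hF]; exact ENNReal.rpow_lt_top_of_nonneg (by positivity) htop⟩
  obtain ⟨φ, hT, hae, hle⟩ := exists_hasTaylorBounds_approx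
    (by simpa using hp.le) ENNReal.ofReal_ne_top hmem fun x => ENNReal.toReal_nonneg
  have hφm : ∀ k, Measurable fun x => ENNReal.ofReal (φ k x) := fun k => by
    obtain ⟨g, m, M, K, L, -, h⟩ := hT k
    exact h.continuous.measurable.ennreal_ofReal
  have hlim : ∀ᵐ x ∂γ, Filter.Tendsto (fun k => ENNReal.ofReal (φ k x)) Filter.atTop
      (nhds (f x)) := by
    filter_upwards [hae, hfin] with x hx hx'
    simpa [ENNReal.ofReal_toReal hx'] using ENNReal.tendsto_ofReal hx
  have hlim₂ := Measure.ae_ae_of_ae_prod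
    ((measurePreserving_stdGaussian_rotation (E := E) hρσ).quasiMeasurePreserving.ae hlim)
  have hk : ∀ k, ∫⁻ x, (∫⁻ y, ENNReal.ofReal (φ k (ρ • x + σ • y)) ∂γ) ^ q ∂γ ≤
      ((∫⁻ x, f x ^ p ∂γ) ^ (1 / p) + ENNReal.ofReal (2 * (1 / ((k : ℝ) + 1)))) ^ q := fun k => by
    obtain ⟨g, m, M, K, L, hm, h⟩ := hT k
    have h1 := h.lintegral_mehler_le hm hρ hρσ hp hq hpq
    have h2 := hle k
    rw [hF, hnorm] at h2
    have h3 : ∀ x, ‖φ k x‖ₑ = ENNReal.ofReal (φ k x) := fun x =>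
      Real.enorm_eq_ofReal (hm.le.trans (h.lower x))
    simp_rw [h3] at h2
    exact (ENNReal.rpow_inv_le_iff hq0).1 (by simpa only [one_div] using h1.trans h2)
  have hklim : Filter.Tendsto (fun k : ℕ => ((∫⁻ x, f x ^ p ∂γ) ^ (1 / p) +
      ENNReal.ofReal (2 * (1 / ((k : ℝ) + 1)))) ^ q) Filter.atTop
      (nhds (((∫⁻ x, f x ^ p ∂γ) ^ (1 / p)) ^ q)) := by
    have := (ENNReal.continuous_rpow_const (y := q)).tendsto _ |>.comp
      ((ENNReal.tendsto_ofReal ((tendsto_one_div_add_atTop_nhds_zero_nat (𝕜 := ℝ)).const_mul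
        2)).const_add ((∫⁻ x, f x ^ p ∂γ) ^ (1 / p)))
    simpa [Function.comp_def] using this
  rw [one_div q, ENNReal.rpow_inv_le_iff hq0]
  calc _ ≤ ∫⁻ x, Filter.liminf (fun k =>
        (∫⁻ y, ENNReal.ofReal (φ k (ρ • x + σ • y)) ∂γ) ^ q) Filter.atTop ∂γ := by
        refine lintegral_mono_ae ?_
        filter_upwards [hlim₂] with x hx
        have h1 : ∫⁻ y, f (ρ • x + σ • y) ∂γ ≤ Filter.liminf (fun k =>
            ∫⁻ y, ENNReal.ofReal (φ k (ρ • x + σ • y)) ∂γ) Filter.atTop := by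
          refine le_trans (le_of_eq ?_) (lintegral_liminf_le fun k =>
            (hφm k).comp (by fun_prop : Measurable fun y : E => ρ • x + σ • y))
          refine lintegral_congr_ae ?_
          filter_upwards [hx] with y hy
          exact hy.liminf_eq.symm
        refine (ENNReal.rpow_le_rpow h1 hq0.le).trans (le_of_eq ?_)
        exact (ENNReal.orderIsoRpow q hq0).liminf_apply
    _ ≤ Filter.liminf (fun k =>
        ∫⁻ x, (∫⁻ y, ENNReal.ofReal (φ k (ρ • x + σ • y)) ∂γ) ^ q ∂γ) Filter.atTop :=
        lintegral_liminf_le fun k => (measurable_mehler ρ σ (hφm k)).pow_const q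
    _ ≤ Filter.liminf (fun k : ℕ => ((∫⁻ x, f x ^ p ∂γ) ^ (1 / p) +
        ENNReal.ofReal (2 * (1 / ((k : ℝ) + 1)))) ^ q) Filter.atTop :=
        Filter.liminf_le_liminf (.of_forall hk)
    _ = _ := hklim.liminf_eq

theorem lintegral_mehler_rpow_le {ρ σ p q : ℝ} (hρ : 0 ≤ ρ) (hρσ : ρ ^ 2 + σ ^ 2 = 1)
    (hp : 1 ≤ p) (hq : 1 ≤ q) (hpq : ρ ^ 2 * (q - 1) ≤ p - 1)
    {f : E → ENNReal} (hf : Measurable f) :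
    (∫⁻ x, (∫⁻ y, f (ρ • x + σ • y) ∂γ) ^ q ∂γ) ^ (1 / q) ≤
      (∫⁻ x, f x ^ p ∂γ) ^ (1 / p) := by
  rcases hq.eq_or_lt with rfl | hq
  · simpa [lintegral_mehler hρσ hf] using lintegral_le_lintegral_rpow hp hf
  rcases hp.eq_or_lt with rfl | hp
  · have hρ0 : ρ = 0 := by
      have : ρ ^ 2 * (q - 1) = 0 :=
        le_antisymm (by linarith) (mul_nonneg (sq_nonneg ρ) (by linarith))
      rcases mul_eq_zero.1 this with h | h
      · exact pow_eq_zero_iff two_ne_zero |>.1 h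
      · linarith
    have h := lintegral_mehler hρσ hf
    subst hρ0
    have hq0 : q ≠ 0 := by linarith
    simp only [zero_smul, zero_add, lintegral_const, measure_univ, mul_one] at h ⊢
    rw [h, one_div, ENNReal.rpow_rpow_inv hq0]
    simp
  · exact lintegral_mehler_rpow_le_of_one_lt hρ hρσ hp hq hpq hf

end Gaussian

/-- Hypercontractivity of the Mehler/Ornstein–Uhlenbeck kernel. -/
theorem mehler_hypercontractivity (n : ℕ) (hn : 1 ≤ n) (ρ p q : ℝ)
    (hρ0 : 0 ≤ ρ) (hρ1 : ρ ≤ 1) (hp : 1 ≤ p) (hq : 1 ≤ q)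
    (hpq : ρ ^ 2 * (q - 1) ≤ p - 1)
    (f : EuclideanSpace ℝ (Fin n) → ENNReal) (hf : Measurable f) :
    (∫⁻ x, (∫⁻ y, f (ρ • x + Real.sqrt (1 - ρ ^ 2) • y) ∂stdGaussian n) ^ q
        ∂stdGaussian n) ^ (1 / q)
      ≤ (∫⁻ x, f x ^ p ∂stdGaussian n) ^ (1 / p) := by
  rw [stdGaussian_eq]
  exact lintegral_mehler_rpow_le hρ0
    (by rw [Real.sq_sqrt (by nlinarith)]; ring) hp hq hpq hf
end

section
/- Let n ≥ 1 be an integer, let (Ω, 𝔉, P) be a probability space, and let X, Z : Ω → ℝⁿ be independent random variables each with law μ. Fix ρ ∈ [0,1] and set Y := ρX + √(1−ρ²)Z. Then for every bounded Borel function F : ℝⁿ → ℝ, the random variable ω ↦ ∫_{ℝⁿ} F(ρ·Y(ω) + √(1−ρ²)·z) dμ(z) is a version of the conditional expectation of F(X) given the σ-algebra generated by Y; that is, E[F∘X | σ(Y)] = ∫_{ℝⁿ} F(ρY + √(1−ρ²)z) dμ(z) holds P-almost surely. -/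
open MeasureTheory

/-- The involutive rotation-reflection `(x, z) ↦ (a x + b z, b x - a z)` of `E × E`, for
`a² + b² = 1`, as a linear isometry of the Hilbert sum. -/
noncomputable def gaussianRotation {E : Type*} [NormedAddCommGroup E] [InnerProductSpace ℝ E]
    (a b : ℝ) (h : a ^ 2 + b ^ 2 = 1) : WithLp 2 (E × E) ≃ₗᵢ[ℝ] WithLp 2 (E × E) where
  toFun p := WithLp.toLp 2 (a • p.fst + b • p.snd, b • p.fst - a • p.snd)
  invFun p := WithLp.toLp 2 (a • p.fst + b • p.snd, b • p.fst - a • p.snd)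
  map_add' p q := by
    apply WithLp.ofLp_injective
    ext1 <;> simp <;> module
  map_smul' c p := by
    apply WithLp.ofLp_injective
    ext1 <;> simp <;> module
  left_inv p := by
    apply WithLp.ofLp_injective
    ext1
    · linear_combination (norm := (simp; module)) h • p.fst
    · linear_combination (norm := (simp; module)) h • p.snd
  right_inv p := by
    apply WithLp.ofLp_injective
    ext1
    · linear_combination (norm := (simp; module)) h • p.fst
    · linear_combination (norm := (simp; module)) h • p.snd
  norm_map' p := by
    rw [← sq_eq_sq₀ (norm_nonneg _) (norm_nonneg _), WithLp.prod_norm_sq_eq_of_L2,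
      WithLp.prod_norm_sq_eq_of_L2]
    simp [norm_add_sq_real, norm_sub_sq_real, norm_smul, inner_smul_left, inner_smul_right,
      mul_pow]
    linear_combination (‖p.fst‖ ^ 2 + ‖p.snd‖ ^ 2) * h

theorem measurePreserving_withDensity_of_comp_eq {α : Type*} [MeasurableSpace α] {ν : Measure α}
    {R : α → α} (hR : MeasurePreserving R ν ν) {g : α → ENNReal} (hg : Measurable g)
    (hgR : ∀ x, g (R x) = g x) :
    MeasurePreserving R (ν.withDensity g) (ν.withDensity g) := by
  refine ⟨hR.measurable, ?_⟩
  ext s hs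
  rw [Measure.map_apply hR.measurable hs, withDensity_apply _ hs,
    withDensity_apply _ (hR.measurable hs), ← hR.setLIntegral_comp_preimage hs hg]
  simp [hgR]

theorem measurePreserving_rotation_stdGaussian (n : ℕ) {a b : ℝ} (h : a ^ 2 + b ^ 2 = 1) :
    MeasurePreserving
      (fun p : EuclideanSpace ℝ (Fin n) × EuclideanSpace ℝ (Fin n) =>
        (a • p.1 + b • p.2, b • p.1 - a • p.2))
      ((stdGaussian n).prod (stdGaussian n)) ((stdGaussian n).prod (stdGaussian n)) := by
  have hvol : MeasurePreserving
      (fun p : EuclideanSpace ℝ (Fin n) × EuclideanSpace ℝ (Fin n) =>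
        (a • p.1 + b • p.2, b • p.1 - a • p.2)) volume volume := by
    have hL := (gaussianRotation (E := EuclideanSpace ℝ (Fin n)) a b h).measurePreserving
    exact (WithLp.volume_preserving_ofLp _ _).comp (hL.comp (WithLp.volume_preserving_toLp _ _))
  have hdens : Measurable fun x : EuclideanSpace ℝ (Fin n) =>
      ENNReal.ofReal ((2 * Real.pi) ^ (-(n : ℝ) / 2) * Real.exp (-‖x‖ ^ 2 / 2)) := by fun_prop
  unfold stdGaussian
  rw [prod_withDensity hdens hdens]
  refine measurePreserving_withDensity_of_comp_eq hvol (by fun_prop) fun p => ?_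
  have hnorm : ‖a • p.1 + b • p.2‖ ^ 2 + ‖b • p.1 - a • p.2‖ ^ 2 = ‖p.1‖ ^ 2 + ‖p.2‖ ^ 2 := by
    have := (gaussianRotation a b h).norm_map (WithLp.toLp 2 p)
    rw [← sq_eq_sq₀ (norm_nonneg _) (norm_nonneg _), WithLp.prod_norm_sq_eq_of_L2,
      WithLp.prod_norm_sq_eq_of_L2] at this
    exact this
  rw [← ENNReal.ofReal_mul (by positivity), ← ENNReal.ofReal_mul (by positivity),
    mul_mul_mul_comm, mul_mul_mul_comm _ (Real.exp (-‖p.1‖ ^ 2 / 2)),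
    ← Real.exp_add, ← Real.exp_add]
  congr 3
  linear_combination -hnorm / 2

/-- The Mehler integral gives a version of the conditional expectation of `F ∘ X`
given `σ(Y)` where `Y = ρ X + √(1-ρ²) Z`. -/
theorem mehler_condexp {Ω : Type*} [MeasurableSpace Ω] (P : Measure Ω)
    [IsProbabilityMeasure P] (n : ℕ) (hn : 1 ≤ n)
    (X Z : Ω → EuclideanSpace ℝ (Fin n)) (hX : Measurable X) (hZ : Measurable Z)
    (hXZ : ProbabilityTheory.IndepFun X Z P)
    (hXlaw : P.map X = stdGaussian n) (hZlaw : P.map Z = stdGaussian n)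
    (ρ : ℝ) (hρ0 : 0 ≤ ρ) (hρ1 : ρ ≤ 1)
    (Y : Ω → EuclideanSpace ℝ (Fin n))
    (hY : Y = fun ω => ρ • X ω + Real.sqrt (1 - ρ ^ 2) • Z ω)
    (F : EuclideanSpace ℝ (Fin n) → ℝ) (hF : Measurable F)
    (C : ℝ) (hFC : ∀ x, |F x| ≤ C) :
    P[(fun ω => F (X ω)) | MeasurableSpace.comap Y inferInstance]
      =ᵐ[P] fun ω =>
        ∫ z, F (ρ • Y ω + Real.sqrt (1 - ρ ^ 2) • z) ∂stdGaussian n := by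
  have hsq : ρ ^ 2 + Real.sqrt (1 - ρ ^ 2) ^ 2 = 1 := by
    rw [Real.sq_sqrt (by nlinarith)]
    ring
  set s := Real.sqrt (1 - ρ ^ 2)
  have : IsProbabilityMeasure (stdGaussian n) :=
    hXlaw ▸ Measure.isProbabilityMeasure_map hX.aemeasurable
  have hrot := measurePreserving_rotation_stdGaussian n hsq
  have hXZlaw : MeasurePreserving (fun ω => (X ω, Z ω)) P
      ((stdGaussian n).prod (stdGaussian n)) := by
    refine ⟨hX.prodMk hZ, ?_⟩
    rw [(ProbabilityTheory.indepFun_iff_map_prod_eq_prod_map_map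
      hX.aemeasurable hZ.aemeasurable).1 hXZ,
      hXlaw, hZlaw]
  have hYW : MeasurePreserving (fun ω => (Y ω, s • X ω - ρ • Z ω)) P
      ((stdGaussian n).prod (stdGaussian n)) := by
    subst hY
    exact hrot.comp hXZlaw
  have hYlaw : MeasurePreserving Y P (stdGaussian n) := measurePreserving_fst.comp hYW
  have hX_eq (ω : Ω) : X ω = ρ • Y ω + s • (s • X ω - ρ • Z ω) := by
    subst hY
    linear_combination (norm := module) -(hsq • X ω)
  have hm : MeasurableSpace.comap Y inferInstance ≤ ‹MeasurableSpace Ω› :=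
    hYlaw.measurable.comap_le
  have hFm : Measurable fun p : EuclideanSpace ℝ (Fin n) × EuclideanSpace ℝ (Fin n) =>
      F (ρ • p.1 + s • p.2) := hF.comp (by fun_prop)
  have hFint : Integrable (fun p : EuclideanSpace ℝ (Fin n) × EuclideanSpace ℝ (Fin n) =>
      F (ρ • p.1 + s • p.2)) ((stdGaussian n).prod (stdGaussian n)) :=
    Integrable.of_bound hFm.aestronglyMeasurable C (ae_of_all _ fun _ => hFC _)
  have hGm : StronglyMeasurable fun y => ∫ z, F (ρ • y + s • z) ∂stdGaussian n :=
    hFm.stronglyMeasurable.integral_prod_right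
  refine (ae_eq_condExp_of_forall_setIntegral_eq hm ?_ ?_ ?_ ?_).symm
  · exact Integrable.of_bound (hF.comp hX).aestronglyMeasurable C (ae_of_all _ fun _ => hFC _)
  · exact fun _ _ _ => (hYlaw.integrable_comp_of_integrable hFint.integral_prod_left).integrableOn
  · rintro _ ⟨A, hA, rfl⟩ -
    calc ∫ ω in Y ⁻¹' A, ∫ z, F (ρ • Y ω + s • z) ∂stdGaussian n ∂P
        = ∫ y in A, ∫ z, F (ρ • y + s • z) ∂stdGaussian n ∂stdGaussian n := by
          rw [← hYlaw.map_eq, setIntegral_map hA (by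
            rw [hYlaw.map_eq]; exact hGm.aestronglyMeasurable) hYlaw.aemeasurable, hYlaw.map_eq]
      _ = ∫ p in A ×ˢ Set.univ, F (ρ • p.1 + s • p.2)
            ∂(stdGaussian n).prod (stdGaussian n) := by
          rw [setIntegral_prod _ hFint.integrableOn]
          simp
      _ = ∫ ω in Y ⁻¹' A, F (X ω) ∂P := by
          rw [← hYW.map_eq, setIntegral_map (hA.prod .univ) hFm.aestronglyMeasurable
            hYW.aemeasurable]
          simp only [← hX_eq]
          congr 2
          ext ω
          simp
  · exact (hGm.comp_measurable (comap_measurable Y)).aestronglyMeasurable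
end

section
/- Let n ≥ 1 be an integer and let f : ℝⁿ → ℝ be a continuously differentiable function such that f and ‖∇f‖ are square-integrable with respect to μ. Then the Poincaré inequality ∫_{ℝⁿ} (f(x) − ∫ f dμ)² dμ(x) ≤ ∫_{ℝⁿ} ‖∇f(x)‖² dμ(x) holds. -/
open MeasureTheory

open ProbabilityTheory (evariance gaussianReal gaussianPDF gaussianPDFReal)
open scoped ENNReal

theorem Real.enorm_sq_eq_ofReal (a : ℝ) : ‖a‖ₑ ^ 2 = ENNReal.ofReal (a ^ 2) := by
  rw [← sq_abs, ENNReal.ofReal_pow (abs_nonneg a), ← Real.norm_eq_abs, ofReal_norm]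

section Variance

variable {α β : Type*} [MeasurableSpace α] [MeasurableSpace β] {μ : Measure α} {ν : Measure β}
  [IsProbabilityMeasure μ] [IsProbabilityMeasure ν]

/-- Bias–variance decomposition. -/
theorem lintegral_enorm_sub_const_sq {X : α → ℝ} (hX : MemLp X 2 μ) (c : ℝ) :
    ∫⁻ x, ‖X x - c‖ₑ ^ 2 ∂μ = evariance X μ + ‖∫ x, X x ∂μ - c‖ₑ ^ 2 := by
  have hint : ∀ a : ℝ, Integrable (fun x => (X x - a) ^ 2) μ := fun a =>
    (hX.sub (memLp_const a)).integrable_sq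
  have hX1 : Integrable X μ := hX.integrable one_le_two
  simp only [evariance, Real.enorm_sq_eq_ofReal]
  rw [← ofReal_integral_eq_lintegral_ofReal (hint _) (.of_forall fun _ => sq_nonneg _),
    ← ofReal_integral_eq_lintegral_ofReal (hint _) (.of_forall fun _ => sq_nonneg _),
    ← ENNReal.ofReal_add (integral_nonneg fun _ => sq_nonneg _) (sq_nonneg _)]
  congr 1
  set m := ∫ x, X x ∂μ with hm
  have hexp : ∀ x, (X x - c) ^ 2 = (X x - m) ^ 2 + (2 * (m - c) * (X x - m) + (m - c) ^ 2) :=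
    fun x => by ring
  have hlin : Integrable (fun x => 2 * (m - c) * (X x - m)) μ :=
    (hX1.sub (integrable_const m)).const_mul _
  have haff : Integrable (fun x => 2 * (m - c) * (X x - m) + (m - c) ^ 2) μ :=
    hlin.add (integrable_const _)
  simp_rw [hexp]
  rw [integral_add (hint m) haff, integral_add hlin (integrable_const _),
    integral_const_mul, integral_sub hX1 (integrable_const m)]
  simp [← hm]

/-- The variance of `X` is half the mean square difference of two independent copies of `X`. -/
theorem lintegral_lintegral_enorm_sub_sq {X : α → ℝ} (hX : MemLp X 2 μ) :
    ∫⁻ y, ∫⁻ x, ‖X x - X y‖ₑ ^ 2 ∂μ ∂μ = 2 * evariance X μ := by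
  simp_rw [lintegral_enorm_sub_const_sq hX]
  rw [lintegral_add_left measurable_const, lintegral_const, measure_univ, mul_one, two_mul]
  congr 1
  simp_rw [evariance, enorm_sub_rev]

theorem enorm_integral_sq_le_lintegral_enorm_sq {X : α → ℝ} (hX : AEStronglyMeasurable X μ) :
    ‖∫ x, X x ∂μ‖ₑ ^ 2 ≤ ∫⁻ x, ‖X x‖ₑ ^ 2 ∂μ := by
  have h := eLpNorm_le_eLpNorm_of_exponent_le (p := 1) (q := 2) one_le_two hX
  rw [eLpNorm_one_eq_lintegral_enorm] at h
  refine (pow_le_pow_left₀ zero_le ((enorm_integral_le_lintegral_enorm X).trans h) 2).trans_eq ?_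
  rw [eLpNorm_eq_lintegral_rpow_enorm_toReal two_ne_zero ENNReal.ofNat_ne_top,
    ← ENNReal.rpow_natCast, ← ENNReal.rpow_mul]
  simp

/-- Square-integrability passes to almost every section. -/
theorem MeasureTheory.MemLp.prod_right_ae_two {f : α × β → ℝ} (hf : MemLp f 2 (μ.prod ν)) :
    ∀ᵐ x ∂μ, MemLp (fun y => f (x, y)) 2 ν := by
  filter_upwards [hf.integrable_sq.prod_right_ae, hf.aestronglyMeasurable.prodMk_left] with x h₁ h₂
  exact (memLp_two_iff_integrable_sq h₂).2 h₁

/-- Square-integrability passes to almost every section. -/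
theorem MeasureTheory.MemLp.prod_left_ae_two {f : α × β → ℝ} (hf : MemLp f 2 (μ.prod ν)) :
    ∀ᵐ y ∂ν, MemLp (fun x => f (x, y)) 2 μ :=
  (hf.comp_measurePreserving Measure.measurePreserving_swap).prod_right_ae_two

/-- Subadditivity of the variance with respect to products of probability spaces. -/
theorem evariance_prod_le {f : α × β → ℝ} (hfm : Measurable f) (hf : MemLp f 2 (μ.prod ν)) :
    evariance f (μ.prod ν) ≤
      ∫⁻ y, evariance (fun x => f (x, y)) μ ∂ν + ∫⁻ x, evariance (fun y => f (x, y)) ν ∂μ := by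
  have hf1 : Integrable f (μ.prod ν) := hf.integrable one_le_two
  have hhm : Measurable fun y => ∫ x, f (x, y) ∂μ :=
    (hfm.comp measurable_swap).stronglyMeasurable.integral_prod_right'.measurable
  have hgm : Measurable fun x => ∫ y, f (x, y) ∂ν :=
    hfm.stronglyMeasurable.integral_prod_right'.measurable
  have key : ∀ᵐ x ∂μ, ∫⁻ y, ‖f (x, y) - ∫ z, f z ∂μ.prod ν‖ₑ ^ 2 ∂ν ≤
      ∫⁻ y, ‖f (x, y) - ∫ x', f (x', y) ∂μ‖ₑ ^ 2 ∂ν + evariance (fun y => f (x, y)) ν := by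
    filter_upwards [hf.prod_right_ae_two] with x hx
    rw [lintegral_enorm_sub_const_sq hx, add_comm]
    gcongr
    rw [integral_prod_symm f hf1, ← integral_sub (hx.integrable one_le_two) hf1.integral_prod_right]
    exact enorm_integral_sq_le_lintegral_enorm_sq
      ((hx.aestronglyMeasurable).sub hhm.aestronglyMeasurable)
  have hm₁ : Measurable fun z : α × β => ‖f z - ∫ x, f (x, z.2) ∂μ‖ₑ ^ 2 :=
    ((hfm.sub (hhm.comp measurable_snd)).enorm).pow_const 2
  calc evariance f (μ.prod ν)
      = ∫⁻ x, ∫⁻ y, ‖f (x, y) - ∫ z, f z ∂μ.prod ν‖ₑ ^ 2 ∂ν ∂μ :=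
        lintegral_prod _ (((hfm.sub_const _).enorm).pow_const 2).aemeasurable
    _ ≤ ∫⁻ x, (∫⁻ y, ‖f (x, y) - ∫ x', f (x', y) ∂μ‖ₑ ^ 2 ∂ν +
          evariance (fun y => f (x, y)) ν) ∂μ :=
        lintegral_mono_ae key
    _ = ∫⁻ x, ∫⁻ y, ‖f (x, y) - ∫ x', f (x', y) ∂μ‖ₑ ^ 2 ∂ν ∂μ
        + ∫⁻ x, evariance (fun y => f (x, y)) ν ∂μ :=
        lintegral_add_left hm₁.lintegral_prod_right' _
    _ = _ := by
        rw [lintegral_lintegral_swap hm₁.aemeasurable]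
        rfl

end Variance

section RealLine

/-- Cauchy–Schwarz for the increment of a `C¹` function. -/
theorem enorm_sub_sq_le_lintegral_deriv {g : ℝ → ℝ} (hg : ContDiff ℝ 1 g) {x y : ℝ} (hxy : x < y) :
    ‖g x - g y‖ₑ ^ 2 ≤ ∫⁻ t in Set.Ico x y, ENNReal.ofReal (y - x) * ‖deriv g t‖ₑ ^ 2 := by
  have hc : Continuous (deriv g) := hg.continuous_deriv le_rfl
  have hint : ∀ h : ℝ → ℝ, Continuous h → IntervalIntegrable h volume x y :=
    fun h hh => hh.intervalIntegrable x y
  have hyx : 0 < y - x := sub_pos.2 hxy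
  have hftc : ∫ t in x..y, deriv g t = g y - g x :=
    intervalIntegral.integral_deriv_eq_sub (fun t _ => hg.differentiable one_ne_zero t) (hint _ hc)
  have hnn : 0 ≤ ∫ t in x..y, ((y - x) * deriv g t - (g y - g x)) ^ 2 :=
    intervalIntegral.integral_nonneg hxy.le fun _ _ => sq_nonneg _
  have hexp : ∀ t, ((y - x) * deriv g t - (g y - g x)) ^ 2 =
      (y - x) ^ 2 * deriv g t ^ 2 - (2 * (y - x) * (g y - g x)) * deriv g t + (g y - g x) ^ 2 :=
    fun t => by ring
  simp_rw [hexp] at hnn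
  rw [intervalIntegral.integral_add (hint _ (by fun_prop)) (hint _ (by fun_prop)),
    intervalIntegral.integral_sub (hint _ (by fun_prop)) (hint _ (by fun_prop)),
    intervalIntegral.integral_const_mul, intervalIntegral.integral_const_mul, hftc,
    intervalIntegral.integral_const, smul_eq_mul] at hnn
  have hle : (g x - g y) ^ 2 ≤ ∫ t in Set.Ioc x y, (y - x) * deriv g t ^ 2 := by
    rw [← intervalIntegral.integral_of_le hxy.le, intervalIntegral.integral_const_mul]
    refine le_of_mul_le_mul_left ?_ hyx
    nlinarith
  rw [setLIntegral_congr Ico_ae_eq_Ioc]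
  simp_rw [Real.enorm_sq_eq_ofReal, ← ENNReal.ofReal_mul hyx.le]
  rw [← ofReal_integral_eq_lintegral_ofReal
    ((intervalIntegrable_iff_integrableOn_Ioc_of_le hxy.le).1 (hint _ (by fun_prop)))
    (.of_forall fun t => by positivity)]
  exact ENNReal.ofReal_le_ofReal hle

theorem hasDerivAt_gaussianPDFReal_std (x : ℝ) :
    HasDerivAt (gaussianPDFReal 0 1) (-(gaussianPDFReal 0 1 x * x)) x := by
  have h : HasDerivAt (fun x : ℝ => (√(2 * Real.pi * (1 : NNReal)))⁻¹ *
      Real.exp (-(x - 0) ^ 2 / (2 * (1 : NNReal)))) _ x :=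
    ((((((hasDerivAt_id x).sub_const 0).pow 2).neg).div_const _).exp).const_mul _
  convert! h using 1
  simp [gaussianPDFReal]
  ring

theorem integrable_gaussianPDFReal_mul_id :
    Integrable (fun x : ℝ => gaussianPDFReal 0 1 x * x) := by
  have h := integrable_mul_exp_neg_mul_sq (b := 1 / 2) (by norm_num)
  refine (h.const_mul (√(2 * Real.pi))⁻¹).congr (.of_forall fun x => ?_)
  simp [gaussianPDFReal]
  ring_nf

theorem tendsto_gaussianPDFReal_std_cocompact :
    Filter.Tendsto (gaussianPDFReal 0 1) (Filter.cocompact ℝ) (nhds 0) := by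
  have h := ((tendsto_rpow_abs_mul_exp_neg_mul_sq_cocompact (a := 1 / 2) (by norm_num) 0).const_mul
    (√(2 * Real.pi))⁻¹)
  rw [mul_zero] at h
  refine h.congr fun x => ?_
  simp only [gaussianPDFReal, Real.rpow_zero, NNReal.coe_one]
  ring_nf

theorem setIntegral_Ioi_id_gaussianReal (t : ℝ) :
    ∫ y in Set.Ioi t, y ∂gaussianReal 0 1 = gaussianPDFReal 0 1 t := by
  rw [ProbabilityTheory.gaussianReal_of_var_ne_zero 0 one_ne_zero]
  have h := integral_Ioi_of_hasDerivAt_of_tendsto' (a := t)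
    (fun x _ => hasDerivAt_gaussianPDFReal_std x)
    integrable_gaussianPDFReal_mul_id.neg.integrableOn
    (tendsto_gaussianPDFReal_std_cocompact.mono_left atTop_le_cocompact)
  rw [setIntegral_withDensity_eq_setIntegral_toReal_smul
    (ProbabilityTheory.measurable_gaussianPDF 0 1) (.of_forall fun _ => ENNReal.ofReal_lt_top) _
    measurableSet_Ioi]
  rw [integral_neg] at h
  simp only [ProbabilityTheory.toReal_gaussianPDF, smul_eq_mul]
  linarith

theorem setIntegral_Iic_id_gaussianReal (t : ℝ) :
    ∫ y in Set.Iic t, y ∂gaussianReal 0 1 = -gaussianPDFReal 0 1 t := by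
  have h := integral_add_compl (f := fun y : ℝ => y) (μ := gaussianReal 0 1)
    (measurableSet_Iic (a := t)) ProbabilityTheory.IsGaussian.integrable_id
  rw [Set.compl_Iic, setIntegral_Ioi_id_gaussianReal,
    ProbabilityTheory.integral_id_gaussianReal] at h
  linarith

theorem lintegral_Iic_prod_Ioi_sub_gaussianReal (t : ℝ) :
    ∫⁻ z in Set.Iic t ×ˢ Set.Ioi t, ENNReal.ofReal (z.2 - z.1)
      ∂(gaussianReal 0 1).prod (gaussianReal 0 1) = gaussianPDF 0 1 t := by
  have hid : Integrable (fun y : ℝ => y) (gaussianReal 0 1) :=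
    ProbabilityTheory.IsGaussian.integrable_id
  have h1 : IntegrableOn (fun z : ℝ × ℝ => z.1) (Set.Iic t ×ˢ Set.Ioi t)
      ((gaussianReal 0 1).prod (gaussianReal 0 1)) := (hid.comp_fst _).integrableOn
  have h2 : IntegrableOn (fun z : ℝ × ℝ => z.2) (Set.Iic t ×ˢ Set.Ioi t)
      ((gaussianReal 0 1).prod (gaussianReal 0 1)) := (hid.comp_snd _).integrableOn
  have h21 : IntegrableOn (fun z : ℝ × ℝ => z.2 - z.1) (Set.Iic t ×ˢ Set.Ioi t)
      ((gaussianReal 0 1).prod (gaussianReal 0 1)) := h2.sub h1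
  rw [← ofReal_integral_eq_lintegral_ofReal h21
    (ae_restrict_of_forall_mem (measurableSet_Iic.prod measurableSet_Ioi)
      fun z hz => sub_nonneg.2 (hz.1.out.trans hz.2.out.le)), integral_sub h2 h1]
  have e2 := setIntegral_prod_mul (μ := gaussianReal 0 1) (ν := gaussianReal 0 1)
    (fun _ => (1 : ℝ)) (fun y => y) (Set.Iic t) (Set.Ioi t)
  have e1 := setIntegral_prod_mul (μ := gaussianReal 0 1) (ν := gaussianReal 0 1)
    (fun y => y) (fun _ => (1 : ℝ)) (Set.Iic t) (Set.Ioi t)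
  have hp := measureReal_add_measureReal_compl (μ := gaussianReal 0 1) (measurableSet_Iic (a := t))
  simp only [one_mul, mul_one, setIntegral_Iic_id_gaussianReal, setIntegral_Ioi_id_gaussianReal,
    integral_const, measureReal_restrict_apply_univ, smul_eq_mul] at e1 e2
  rw [Set.compl_Iic, probReal_univ] at hp
  rw [e1, e2, gaussianPDF]
  congr 1
  linear_combination gaussianPDFReal 0 1 t * hp

/-- The Gaussian Poincaré inequality on the real line. -/
theorem evariance_gaussianReal_le {g : ℝ → ℝ} (hg : ContDiff ℝ 1 g)
    (hg2 : MemLp g 2 (gaussianReal 0 1)) :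
    evariance g (gaussianReal 0 1) ≤ ∫⁻ t, ‖deriv g t‖ₑ ^ 2 ∂gaussianReal 0 1 := by
  have hdm : Measurable fun t => ‖deriv g t‖ₑ ^ 2 :=
    ((hg.continuous_deriv le_rfl).measurable.enorm).pow_const 2
  let A : ℝ × ℝ → ℝ → ℝ≥0∞ := fun z t =>
    (Set.Iic t ×ˢ Set.Ioi t).indicator (fun z => ENNReal.ofReal (z.2 - z.1)) z * ‖deriv g t‖ₑ ^ 2
  have hAm : Measurable (Function.uncurry A) := by
    have hs : MeasurableSet {p : (ℝ × ℝ) × ℝ | p.1.1 ≤ p.2 ∧ p.2 < p.1.2} :=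
      (measurableSet_le (f := fun p : (ℝ × ℝ) × ℝ => p.1.1) (by fun_prop) measurable_snd).inter
        (measurableSet_lt (g := fun p : (ℝ × ℝ) × ℝ => p.1.2) measurable_snd (by fun_prop))
    have hm : Measurable fun p : (ℝ × ℝ) × ℝ => ENNReal.ofReal (p.1.2 - p.1.1) := by fun_prop
    exact (hm.indicator hs).mul (hdm.comp measurable_snd)
  let B : ℝ × ℝ → ℝ≥0∞ := fun z => ∫⁻ t, A z t
  have hBm : Measurable B := hAm.lintegral_prod_right'
  have hB : ∀ x y, x < y → ‖g x - g y‖ₑ ^ 2 ≤ B (x, y) := fun x y hxy => by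
    refine (enorm_sub_sq_le_lintegral_deriv hg hxy).trans_eq ?_
    rw [← lintegral_indicator measurableSet_Ico]
    refine lintegral_congr fun t => ?_
    by_cases ht : x ≤ t ∧ t < y
    · simp [A, Set.indicator, ht]
    · simp [A, Set.indicator, ht]
  have hle : ∀ x y, ‖g x - g y‖ₑ ^ 2 ≤ B (x, y) + B (y, x) := fun x y => by
    rcases lt_trichotomy x y with h | rfl | h
    · exact (hB x y h).trans le_self_add
    · simp
    · rw [enorm_sub_rev]
      exact (hB y x h).trans le_add_self
  have hBint : ∫⁻ z, B z ∂(gaussianReal 0 1).prod (gaussianReal 0 1) =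
      ∫⁻ t, ‖deriv g t‖ₑ ^ 2 ∂gaussianReal 0 1 := by
    rw [lintegral_lintegral_swap hAm.aemeasurable,
      ProbabilityTheory.gaussianReal_of_var_ne_zero 0 one_ne_zero,
      lintegral_withDensity_eq_lintegral_mul _ (ProbabilityTheory.measurable_gaussianPDF 0 1) hdm,
      ← ProbabilityTheory.gaussianReal_of_var_ne_zero 0 one_ne_zero]
    refine lintegral_congr fun t => ?_
    have hs : MeasurableSet (Set.Iic t ×ˢ Set.Ioi t) := measurableSet_Iic.prod measurableSet_Ioi
    have hm : Measurable fun z : ℝ × ℝ => ENNReal.ofReal (z.2 - z.1) := by fun_prop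
    rw [lintegral_mul_const _ (hm.indicator hs), lintegral_indicator hs,
      lintegral_Iic_prod_Ioi_sub_gaussianReal, Pi.mul_apply]
  refine (ENNReal.mul_le_mul_iff_right two_ne_zero ENNReal.ofNat_ne_top).1 ?_
  calc 2 * evariance g (gaussianReal 0 1)
      = ∫⁻ y, ∫⁻ x, ‖g x - g y‖ₑ ^ 2 ∂gaussianReal 0 1 ∂gaussianReal 0 1 :=
        (lintegral_lintegral_enorm_sub_sq hg2).symm
    _ ≤ ∫⁻ y, ∫⁻ x, (B (x, y) + B (y, x)) ∂gaussianReal 0 1 ∂gaussianReal 0 1 :=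
        lintegral_mono fun y => lintegral_mono fun x => hle x y
    _ = ∫⁻ y, ∫⁻ x, B (x, y) ∂gaussianReal 0 1 ∂gaussianReal 0 1 +
        ∫⁻ y, ∫⁻ x, B (y, x) ∂gaussianReal 0 1 ∂gaussianReal 0 1 := by
        rw [← lintegral_add_left hBm.lintegral_prod_left']
        exact lintegral_congr fun y => lintegral_add_left (hBm.comp measurable_prodMk_right) _
    _ = 2 * ∫⁻ t, ‖deriv g t‖ₑ ^ 2 ∂gaussianReal 0 1 := by
        rw [← lintegral_prod_symm' _ hBm, ← lintegral_prod _ hBm.aemeasurable, hBint, two_mul]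

end RealLine

section Pi

theorem deriv_comp_update {n : ℕ} {f : (Fin n → ℝ) → ℝ} (hf : Differentiable ℝ f) (x : Fin n → ℝ)
    (i : Fin n) :
    deriv (fun t => f (Function.update x i t)) (x i) = fderiv ℝ f x (Pi.single i 1) := by
  have h : HasFDerivAt f (fderiv ℝ f x) (Function.update x i (x i)) := by
    rw [Function.update_eq_self]
    exact (hf x).hasFDerivAt
  exact (h.comp_hasDerivAt (x i) (hasDerivAt_update x i (x i))).deriv

theorem measurable_deriv_comp_update {n : ℕ} {f : (Fin n → ℝ) → ℝ} (hf : ContDiff ℝ 1 f)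
    (i : Fin n) : Measurable fun x => deriv (fun t => f (Function.update x i t)) (x i) := by
  simp_rw [deriv_comp_update (hf.differentiable one_ne_zero)]
  have := hf.continuous_fderiv one_ne_zero
  exact Continuous.measurable (by fun_prop)

theorem measurePreserving_finCons_pi {n : ℕ} (μ : Measure ℝ) [SigmaFinite μ] :
    MeasurePreserving (fun z : ℝ × (Fin n → ℝ) => (Fin.cons z.1 z.2 : Fin (n + 1) → ℝ))
      (μ.prod (Measure.pi fun _ => μ)) (Measure.pi fun _ => μ) := by
  have h := (measurePreserving_piFinSuccAbove (fun _ : Fin (n + 1) => μ) 0).symm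
  convert! h using 1
  ext z i
  simp [MeasurableEquiv.piFinSuccAbove]

/-- The Gaussian Poincaré inequality on a finite product of real lines. -/
theorem evariance_pi_gaussianReal_le {n : ℕ} {f : (Fin n → ℝ) → ℝ} (hf : ContDiff ℝ 1 f)
    (hf2 : MemLp f 2 (Measure.pi fun _ => gaussianReal 0 1)) :
    evariance f (Measure.pi fun _ => gaussianReal 0 1) ≤
      ∑ i, ∫⁻ x, ‖deriv (fun t => f (Function.update x i t)) (x i)‖ₑ ^ 2
        ∂Measure.pi fun _ => gaussianReal 0 1 := by
  induction n with
  | zero =>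
    have h : f = fun _ => f 0 := funext fun x => congrArg f (Subsingleton.elim _ _)
    rw [h]
    simp [evariance]
  | succ n ih =>
    have hmp := measurePreserving_finCons_pi (n := n) (gaussianReal 0 1)
    have hF : ContDiff ℝ 1 fun z : ℝ × (Fin n → ℝ) => f (Fin.cons z.1 z.2) := by
      refine hf.comp (contDiff_pi.2 fun i => ?_)
      refine Fin.cases ?_ (fun j => ?_) i
      · simpa using contDiff_fst
      · simp only [Fin.cons_succ]
        fun_prop
    have hF2 := hf2.comp_measurePreserving hmp
    have hD : ∀ i, Measurable fun x : Fin (n + 1) → ℝ =>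
        ‖deriv (fun t => f (Function.update x i t)) (x i)‖ₑ ^ 2 :=
      fun i => (measurable_deriv_comp_update hf i).enorm.pow_const 2
    have hev : evariance f (Measure.pi fun _ => gaussianReal 0 1) =
        evariance (fun z : ℝ × (Fin n → ℝ) => f (Fin.cons z.1 z.2))
          ((gaussianReal 0 1).prod (Measure.pi fun _ => gaussianReal 0 1)) := by
      rw [evariance, evariance, ← hmp.map_eq,
        integral_map hmp.measurable.aemeasurable hf.continuous.aestronglyMeasurable,
        lintegral_map ((hf.continuous.measurable.sub_const _).enorm.pow_const 2) hmp.measurable]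
    rw [hev]
    refine (evariance_prod_le hF.continuous.measurable hF2).trans ?_
    rw [Fin.sum_univ_succ]
    refine add_le_add ?_ ?_
    · rw [← hmp.lintegral_comp (hD 0)]
      refine le_of_le_of_eq ?_ (lintegral_prod_symm' _ ((hD 0).comp hmp.measurable)).symm
      refine lintegral_mono_ae ?_
      filter_upwards [hF2.prod_left_ae_two] with y hy
      have hc : ContDiff ℝ 1 fun x => f (Fin.cons x y) :=
        hF.comp (contDiff_id.prodMk contDiff_const)
      simpa using evariance_gaussianReal_le hc hy
    · calc ∫⁻ x, evariance (fun y => f (Fin.cons x y)) _ ∂gaussianReal 0 1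
          ≤ ∫⁻ x, ∑ i : Fin n, ∫⁻ y : Fin n → ℝ,
            ‖deriv (fun t => f (Function.update (Fin.cons x y : Fin (n + 1) → ℝ) i.succ t))
              (y i)‖ₑ ^ 2
              ∂(Measure.pi fun _ => gaussianReal 0 1) ∂gaussianReal 0 1 := by
            refine lintegral_mono_ae ?_
            filter_upwards [hF2.prod_right_ae_two] with x hx
            have hc : ContDiff ℝ 1 fun y => f (Fin.cons x y) :=
              hF.comp (contDiff_const.prodMk contDiff_id)
            simpa only [Fin.cons_update] using ih hc hx
        _ = _ := by
            rw [lintegral_finsetSum]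
            · refine Finset.sum_congr rfl fun i _ => ?_
              rw [← hmp.lintegral_comp (hD i.succ)]
              exact (lintegral_prod _ ((hD i.succ).comp hmp.measurable).aemeasurable).symm
            · intro i _
              have := ((hD i.succ).comp hmp.measurable).lintegral_prod_right'
                (ν := Measure.pi fun _ : Fin n => gaussianReal 0 1)
              simpa using this

/-- The standard Gaussian measure has independent standard normal coordinates. -/
theorem map_toLp_pi_gaussianReal (n : ℕ) :
    (Measure.pi fun _ : Fin n => gaussianReal 0 1).map (WithLp.toLp 2) = stdGaussian n := by
  have hpi : (Measure.pi fun _ : Fin n => gaussianReal 0 1) =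
      volume.withDensity fun x : Fin n → ℝ => ENNReal.ofReal (∏ i, gaussianPDFReal 0 1 (x i)) := by
    refine (Measure.pi_eq fun s hs => ?_)
    have hint : ∀ i, IntegrableOn (gaussianPDFReal 0 1) (s i) := fun i =>
      (ProbabilityTheory.integrable_gaussianPDFReal 0 1).integrableOn
    rw [withDensity_apply _ (MeasurableSet.univ_pi hs), volume_pi, Measure.restrict_pi_pi,
      ← ofReal_integral_eq_lintegral_ofReal (Integrable.fintype_prod hint)
        (.of_forall fun x => Finset.prod_nonneg fun i _ =>
          ProbabilityTheory.gaussianPDFReal_nonneg 0 1 _),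
      integral_fintype_prod_eq_prod (fun _ => gaussianPDFReal 0 1),
      ENNReal.ofReal_prod_of_nonneg fun i _ =>
        integral_nonneg fun _ => ProbabilityTheory.gaussianPDFReal_nonneg 0 1 _]
    exact Finset.prod_congr rfl fun i _ =>
      (ProbabilityTheory.gaussianReal_apply_eq_integral 0 one_ne_zero _).symm
  have hdens : ∀ x : Fin n → ℝ, ∏ i, gaussianPDFReal 0 1 (x i) =
      (2 * Real.pi) ^ (-(n : ℝ) / 2) * Real.exp (-‖WithLp.toLp 2 x‖ ^ 2 / 2) := fun x => by
    have hpos : (0 : ℝ) ≤ 2 * Real.pi := by positivity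
    simp only [gaussianPDFReal, Finset.prod_mul_distrib, Finset.prod_const, Finset.card_univ,
      Fintype.card_fin, ← Real.exp_sum, EuclideanSpace.real_norm_sq_eq]
    congr 1
    · rw [NNReal.coe_one, mul_one, Real.sqrt_eq_rpow, ← Real.rpow_neg hpos, ← Real.rpow_natCast,
        ← Real.rpow_mul hpos]
      ring_nf
    · simp [Finset.sum_div, neg_div]
  have hemb := (MeasurableEquiv.toLp 2 (Fin n → ℝ)).measurableEmbedding
  have hvol := PiLp.volume_preserving_toLp (Fin n)
  ext s hs
  rw [Measure.map_apply hvol.measurable hs, hpi,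
    withDensity_apply _ (hvol.measurable hs), stdGaussian, withDensity_apply _ hs,
    ← hvol.setLIntegral_comp_preimage_emb hemb]
  simp_rw [hdens]

end Pi

theorem enorm_gradient_sq {n : ℕ} {f : EuclideanSpace ℝ (Fin n) → ℝ} (hf : Differentiable ℝ f)
    (x : Fin n → ℝ) :
    ENNReal.ofReal (‖gradient f (WithLp.toLp 2 x)‖ ^ 2) =
      ∑ i, ‖deriv (fun t => f (WithLp.toLp 2 (Function.update x i t))) (x i)‖ₑ ^ 2 := by
  have hcoord : ∀ i, deriv (fun t => f (WithLp.toLp 2 (Function.update x i t))) (x i) =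
      gradient f (WithLp.toLp 2 x) i := fun i => by
    have h : HasFDerivAt (fun y : Fin n → ℝ => f (WithLp.toLp 2 y)) _ x :=
      (hf (WithLp.toLp 2 x)).hasGradientAt.hasFDerivAt.comp x
        (PiLp.hasFDerivAt_toLp 2 x)
    have hd : Differentiable ℝ fun y : Fin n → ℝ => f (WithLp.toLp 2 y) := fun y =>
      (hf _).comp y (PiLp.hasFDerivAt_toLp 2 y).differentiableAt
    rw [deriv_comp_update hd x i, h.fderiv]
    change inner ℝ (gradient f (WithLp.toLp 2 x)) (EuclideanSpace.single i 1) = _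
    rw [EuclideanSpace.inner_single_right]
    simp
  simp_rw [hcoord, Real.enorm_sq_eq_ofReal]
  rw [← ENNReal.ofReal_sum_of_nonneg fun _ _ => sq_nonneg _, EuclideanSpace.real_norm_sq_eq]

/-- The Gaussian Poincaré inequality. -/
theorem gaussian_poincare (n : ℕ) (hn : 1 ≤ n)
    (f : EuclideanSpace ℝ (Fin n) → ℝ) (hf : ContDiff ℝ 1 f)
    (hf2 : Integrable (fun x => (f x) ^ 2) (stdGaussian n))
    (hgrad2 : Integrable (fun x => ‖gradient f x‖ ^ 2) (stdGaussian n)) :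
    ∫ x, (f x - ∫ y, f y ∂stdGaussian n) ^ 2 ∂stdGaussian n
      ≤ ∫ x, ‖gradient f x‖ ^ 2 ∂stdGaussian n := by
  have hcont : Continuous f := hf.continuous
  have hmp : MeasurePreserving (WithLp.toLp 2) (Measure.pi fun _ : Fin n => gaussianReal 0 1)
      (stdGaussian n) := ⟨by fun_prop, map_toLp_pi_gaussianReal n⟩
  have hemb := (MeasurableEquiv.toLp 2 (Fin n → ℝ)).measurableEmbedding
  have hf' : ContDiff ℝ 1 fun x : Fin n → ℝ => f (WithLp.toLp 2 x) :=
    hf.comp (PiLp.contDiff_toLp (p := 2))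
  have hL2 : MemLp f 2 (stdGaussian n) :=
    (memLp_two_iff_integrable_sq hcont.aestronglyMeasurable).2 hf2
  have hP := evariance_pi_gaussianReal_le hf' (hL2.comp_measurePreserving hmp)
  have hDm : ∀ i, Measurable fun x : Fin n → ℝ =>
      ‖deriv (fun t => f (WithLp.toLp 2 (Function.update x i t))) (x i)‖ₑ ^ 2 :=
    fun i => (measurable_deriv_comp_update hf' i).enorm.pow_const 2
  rw [← lintegral_finsetSum _ fun i _ => hDm i, evariance] at hP
  simp_rw [← enorm_gradient_sq (hf.differentiable one_ne_zero)] at hP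
  rw [hmp.integral_comp hemb, hmp.lintegral_comp_emb hemb (fun x => ‖f x - _‖ₑ ^ 2),
    hmp.lintegral_comp_emb hemb (fun x => ENNReal.ofReal (‖gradient f x‖ ^ 2)),
    ← ofReal_integral_eq_lintegral_ofReal hgrad2 (.of_forall fun _ => sq_nonneg _)] at hP
  simp_rw [Real.enorm_sq_eq_ofReal] at hP
  rw [integral_eq_lintegral_of_nonneg_ae (.of_forall fun _ => sq_nonneg _)
    (Continuous.aestronglyMeasurable (by fun_prop))]
  exact ENNReal.toReal_le_of_le_ofReal (integral_nonneg fun _ => sq_nonneg _) hP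
end

section
/- Let d ≥ 1 be an integer and let γ be a centered Gaussian measure on ℝᵈ. Let U : ℝ → ℝ be convex and bounded from below, and let V : ℝᵈ → ℝ be continuously differentiable. Then ∫_{ℝᵈ}∫_{ℝᵈ} U(V(x) − V(y)) dγ(x) dγ(y) ≤ ∫_{ℝᵈ}∫_{ℝᵈ} U((π/2)·⟨∇V(x), y⟩) dγ(x) dγ(y), where both double integrals are well defined with values in (−∞, +∞] because U is bounded below. -/
open MeasureTheory ProbabilityTheory
open scoped RealInnerProductSpace

/-- Jensen's inequality combined with the fundamental theorem of calculus: a convex nonnegative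
function of an increment `φ b - φ a` is at most the mean over `(a, b]` of its values at
`b - a` times the derivative of `φ`. -/
lemma ConvexOn.ofReal_sub_le_lintegral_deriv {W : ℝ → ℝ} (hW : ConvexOn ℝ Set.univ W)
    (hW0 : ∀ s, 0 ≤ W s) {a b : ℝ} (hab : a < b) {φ φ' : ℝ → ℝ}
    (hφ : ∀ t, HasDerivAt φ (φ' t) t) (hφ' : Continuous φ') :
    ENNReal.ofReal (W (φ b - φ a))
      ≤ ∫⁻ t, ENNReal.ofReal (W ((b - a) * φ' t)) ∂(volume[|Set.Ioc a b]) := by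
  have hvol : (volume : Measure ℝ) (Set.Ioc a b) = ENNReal.ofReal (b - a) := Real.volume_Ioc
  have hvol0 : (volume : Measure ℝ) (Set.Ioc a b) ≠ 0 := by simp [hab]
  have : IsProbabilityMeasure (volume[|Set.Ioc a b]) := cond_isProbabilityMeasure_of_finite hvol0 (by simp)
  have hWc : Continuous W := continuousOn_univ.mp (hW.continuousOn isOpen_univ)
  have integrable_of_continuous {f : ℝ → ℝ} (hf : Continuous f) :
      Integrable f (volume[|Set.Ioc a b]) :=
    (hf.integrableOn_Ioc (μ := volume)).smul_measure (ENNReal.inv_ne_top.mpr hvol0)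
  have hWint : Integrable (fun t ↦ W ((b - a) * φ' t)) (volume[|Set.Ioc a b]) :=
    integrable_of_continuous (by fun_prop)
  have hmean : ∫ t, (b - a) * φ' t ∂(volume[|Set.Ioc a b]) = φ b - φ a := by
    rw [ProbabilityTheory.cond, integral_smul_measure, integral_const_mul,
      ← intervalIntegral.integral_of_le hab.le,
      intervalIntegral.integral_eq_sub_of_hasDerivAt (fun t _ ↦ hφ t)
        (hφ'.intervalIntegrable a b), hvol, ENNReal.toReal_inv,
      ENNReal.toReal_ofReal (sub_nonneg.mpr hab.le), smul_eq_mul,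
      inv_mul_cancel_left₀ (sub_pos.mpr hab).ne']
  rw [← ofReal_integral_eq_lintegral_ofReal hWint (.of_forall fun t ↦ hW0 _), ← hmean]
  exact ENNReal.ofReal_le_ofReal <| hW.map_integral_le hWc.continuousOn isClosed_univ
    (by simp) (integrable_of_continuous (by fun_prop)) hWint

section

variable {E : Type*} [NormedAddCommGroup E] [NormedSpace ℝ E] [MeasurableSpace E] [BorelSpace E]

lemma integral_strongDual_eq_zero_of_map_eq_gaussianReal {μ : Measure E}
    {L : StrongDual ℝ E} {v : NNReal} (h : μ.map L = gaussianReal 0 v) : μ[L] = 0 := by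
  have := integral_map (μ := μ) (φ := L) (by fun_prop) (f := id) (by fun_prop)
  simpa [h] using this.symm

lemma isGaussian_of_forall_map_eq_gaussianReal {μ : Measure E}
    (h : ∀ L : StrongDual ℝ E, ∃ v : NNReal, μ.map L = gaussianReal 0 v) : IsGaussian μ where
  map_eq_gaussianReal L := by
    obtain ⟨v, hv⟩ := h L
    have hvar : Var[L; μ] = v := by
      have := variance_map (μ := μ) (Y := L) (X := id) (by fun_prop) (by fun_prop)
      simpa [hv] using this.symm
    rw [hv, hvar, integral_strongDual_eq_zero_of_map_eq_gaussianReal hv, Real.toNNReal_coe]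

/-- If `μ.prod μ` is invariant under rotations, then a convex nonnegative function of the increment
of a `C¹` function `V` between two independent points is controlled in mean by the derivative
of `V`. -/
lemma lintegral_convexOn_sub_le_of_map_rotation_eq_self [SecondCountableTopology E]
    {μ : Measure E} [SFinite μ]
    (hμ : ∀ θ : ℝ, (μ.prod μ).map (ContinuousLinearMap.rotation θ) = μ.prod μ)
    {W : ℝ → ℝ} (hW : ConvexOn ℝ Set.univ W) (hW0 : ∀ s, 0 ≤ W s)
    {V : E → ℝ} (hV : ContDiff ℝ 1 V) :
    ∫⁻ z, ENNReal.ofReal (W (V z.2 - V z.1)) ∂(μ.prod μ)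
      ≤ ∫⁻ z, ENNReal.ofReal (W (Real.pi / 2 * fderiv ℝ V z.1 z.2)) ∂(μ.prod μ) := by
  have hWc : Continuous W := continuousOn_univ.mp (hW.continuousOn isOpen_univ)
  have hV' : Continuous (fderiv ℝ V) := hV.continuous_fderiv one_ne_zero
  have hpi : (0 : ℝ) < Real.pi / 2 := by positivity
  let ν : Measure ℝ := volume[|Set.Ioc 0 (Real.pi / 2)]
  have : IsProbabilityMeasure ν :=
    cond_isProbabilityMeasure_of_finite (by simp [Real.pi_pos]) (by simp)
  let F : E × E → ENNReal := fun z ↦ ENNReal.ofReal (W (Real.pi / 2 * fderiv ℝ V z.1 z.2))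
  have hF : Continuous F := ENNReal.continuous_ofReal.comp (by fun_prop)
  have hrot : Continuous fun p : (E × E) × ℝ ↦ ContinuousLinearMap.rotation p.2 p.1 := by
    simp only [ContinuousLinearMap.rotation_apply]
    fun_prop
  have hpath (z : E × E) : ENNReal.ofReal (W (V z.2 - V z.1))
      ≤ ∫⁻ θ, F (ContinuousLinearMap.rotation θ z) ∂ν := by
    have hderiv (θ : ℝ) : HasDerivAt (fun θ ↦ V (ContinuousLinearMap.rotation θ z).1)
        (fderiv ℝ V (ContinuousLinearMap.rotation θ z).1
          (ContinuousLinearMap.rotation θ z).2) θ := by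
      have hcurve : HasDerivAt (fun θ ↦ (ContinuousLinearMap.rotation θ z).1)
          (ContinuousLinearMap.rotation θ z).2 θ := by
        simpa only [ContinuousLinearMap.rotation_apply] using
          ((Real.hasDerivAt_cos θ).smul_const z.1).fun_add ((Real.hasDerivAt_sin θ).smul_const z.2)
      exact ((hV.differentiable one_ne_zero _).hasFDerivAt).comp_hasDerivAt θ hcurve
    have hcont : Continuous fun θ : ℝ ↦ ContinuousLinearMap.rotation θ z :=
      hrot.comp (g := fun p : (E × E) × ℝ ↦ ContinuousLinearMap.rotation p.2 p.1)
        (f := fun θ ↦ (z, θ)) (by fun_prop)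
    simpa [F, ν, ContinuousLinearMap.rotation_apply] using
      hW.ofReal_sub_le_lintegral_deriv hW0 hpi hderiv (by fun_prop)
  calc ∫⁻ z, ENNReal.ofReal (W (V z.2 - V z.1)) ∂(μ.prod μ)
      ≤ ∫⁻ z, ∫⁻ θ, F (ContinuousLinearMap.rotation θ z) ∂ν ∂(μ.prod μ) := lintegral_mono hpath
    _ = ∫⁻ θ, ∫⁻ z, F (ContinuousLinearMap.rotation θ z) ∂(μ.prod μ) ∂ν :=
        lintegral_lintegral_swap (hF.comp hrot).measurable.aemeasurable
    _ = ∫⁻ _, ∫⁻ z, F z ∂(μ.prod μ) ∂ν := by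
        congr with θ
        conv_rhs => rw [← hμ θ, lintegral_map hF.measurable (by fun_prop)]
    _ = ∫⁻ z, F z ∂(μ.prod μ) := by simp

end

/-- Coupling inequality for centered Gaussian measures on `ℝᵈ`:
for `U` convex bounded below (by `c`) and `V` of class `C¹`,
`∫∫ U(V(x) - V(y)) dγ dγ ≤ ∫∫ U((π/2)⟨∇V(x), y⟩) dγ dγ`,
the integrals being taken in `(-∞, +∞]` (here after subtraction of the lower
bound `c`, as lower Lebesgue integrals). -/
theorem gaussian_coupling_inequality (d : ℕ) (hd : 1 ≤ d)
    (γ : Measure (EuclideanSpace ℝ (Fin d))) [IsProbabilityMeasure γ]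
    (hγ : ∀ L : EuclideanSpace ℝ (Fin d) →L[ℝ] ℝ, ∃ v : NNReal,
      γ.map L = gaussianReal 0 v)
    (U : ℝ → ℝ) (hU : ConvexOn ℝ Set.univ U) (c : ℝ) (hUc : ∀ t, c ≤ U t)
    (V : EuclideanSpace ℝ (Fin d) → ℝ) (hV : ContDiff ℝ 1 V) :
    ∫⁻ x, ∫⁻ y, ENNReal.ofReal (U (V x - V y) - c) ∂γ ∂γ
      ≤ ∫⁻ x, ∫⁻ y,
          ENNReal.ofReal (U (Real.pi / 2 * ⟪gradient V x, y⟫) - c) ∂γ ∂γ := by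
  have : IsGaussian γ := isGaussian_of_forall_map_eq_gaussianReal hγ
  have hrot := IsGaussian.map_rotation_eq_self_of_forall_strongDual_eq_zero (μ := γ)
    fun L ↦ integral_strongDual_eq_zero_of_map_eq_gaussianReal (hγ L).choose_spec
  have hUcont : Continuous U := continuousOn_univ.mp (hU.continuousOn isOpen_univ)
  have hVc : Continuous V := hV.continuous
  have hV' : Continuous (fderiv ℝ V) := hV.continuous_fderiv one_ne_zero
  simp only [inner_gradient_left]
  rw [lintegral_lintegral_symm (by unfold Function.uncurry; fun_prop),
    lintegral_lintegral (by unfold Function.uncurry; fun_prop)]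
  exact lintegral_convexOn_sub_le_of_map_rotation_eq_self hrot
    (W := fun s ↦ U s - c) (hU.sub (concaveOn_const c convex_univ))
    (fun s ↦ sub_nonneg.mpr (hUc s)) hV
end
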